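/- Fix an initial state s₀ ∈ S, a collection 𝒟 = (𝒟^i)_{i∈I} of partitions of the set of states such that for every player i the partition 𝒟^i satisfies Property P' with respect to player i, and cutoffs c = (c^i)_{i∈I} such that c^i(D) ≥ overline-v^i_1(s) for every player i, every element D ∈ 𝒟^i, and every state s ∈ D. Let λ ↦ x_λ be a function assigning to every discount factor λ ∈ [0,1) a stationary equilibrium of the modified game Γ̂_λ(s₀;𝒟,c). Then for every player i, liminf_{λ→1} γ̂^i_λ(s₀,x_λ;𝒟^i,c^i) ≥ overline-v^i_1(s₀). -/

import Mathlib

open MeasureTheory Filter Topology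
open scoped ENNReal

noncomputable section

/-- A finite stochastic game: a finite set of players `I`, a finite set of states `S`,
finite nonempty action sets `A i s`, stage payoffs `u` bounded by `1` in absolute value,
and transition probabilities `q`. -/
structure StocGame where
  (I : Type)
  (S : Type)
  (A : I → S → Type)
  [fintypeI : Fintype I]
  [fintypeS : Fintype S]
  [decI : DecidableEq I]
  [decS : DecidableEq S]
  [fintypeA : ∀ i s, Fintype (A i s)]
  [decA : ∀ i s, DecidableEq (A i s)]
  [nonemptyA : ∀ i s, Nonempty (A i s)]
  (u : I → (s : S) → ((j : I) → A j s) → ℝ)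
  (u_bdd : ∀ i s a, |u i s a| ≤ 1)
  (q : (s : S) → ((j : I) → A j s) → S → ℝ)
  (q_nonneg : ∀ s a s', 0 ≤ q s a s')
  (q_sum : ∀ s a, ∑ s', q s a s' = 1)

namespace StocGame

attribute [instance] fintypeI fintypeS decI decS fintypeA decA nonemptyA

/-- A mixed action over a finite set of actions. -/
abbrev Mixed (α : Type) [Fintype α] : Type := {f : α → ℝ // (∀ a, 0 ≤ f a) ∧ ∑ a, f a = 1}

variable {G : StocGame}

/-- Action profiles available at state `s`. -/
abbrev Prof (G : StocGame) (s : G.S) : Type := (j : G.I) → G.A j s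

/-- A pair of a state together with an action profile at that state. -/
abbrev Step (G : StocGame) : Type := Σ s : G.S, G.Prof s

/-- A finite history: a (reversed) list of past (state, action profile) steps,
together with the current state. -/
abbrev Hist (G : StocGame) : Type := List G.Step × G.S

/-- A behavior strategy of player `i`. -/
abbrev BStrat (G : StocGame) (i : G.I) : Type := (h : G.Hist) → Mixed (G.A i h.2)

/-- A (behavior) strategy profile. -/
abbrev Profile (G : StocGame) : Type := (i : G.I) → G.BStrat i

/-- A stationary strategy of player `i`. -/
abbrev Stat (G : StocGame) (i : G.I) : Type := (s : G.S) → Mixed (G.A i s)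

/-- A stationary strategy profile. -/
abbrev StatProf (G : StocGame) : Type := (i : G.I) → G.Stat i

/-- The behavior strategy profile induced by a stationary strategy profile. -/
def toB (x : G.StatProf) : G.Profile := fun i h => x i h.2

/-- The behavior strategy induced by a stationary strategy. -/
def toB1 {i : G.I} (x : G.Stat i) : G.BStrat i := fun h => x h.2

/-- A stationary strategy profile is pure if at every state each player
puts probability `1` on a single action. -/
def IsPureStat (x : G.StatProf) : Prop :=
  ∀ (i : G.I) (s : G.S), ∃ a : G.A i s, ∀ b, (x i s).1 b = if b = a then 1 else 0

/-- The probability, under strategy profile `σ` and initial state `s0`, that the play follows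
the finite history whose (reversed) list of steps is the first argument and whose current
state is the second argument. -/
def probHistAux (s0 : G.S) (σ : G.Profile) : List G.Step → G.S → ℝ
  | [], s => if s = s0 then 1 else 0
  | ⟨s', a⟩ :: rest, s =>
      probHistAux s0 σ rest s' * (∏ i, (σ i (rest, s')).1 (a i)) * G.q s' a s

/-- The probability that the play follows the finite history `h`. -/
def probHist (s0 : G.S) (σ : G.Profile) (h : G.Hist) : ℝ := probHistAux s0 σ h.1 h.2

/-- The expected `lam`-discounted time `t_lam(s0,σ;s,a)` that the play spends at the
state-action pair `st = (s,a)`. -/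
def tStep (lam : ℝ) (s0 : G.S) (σ : G.Profile) (st : G.Step) : ℝ :=
  (1 - lam) *
    ∑' h : G.Hist, (if h.1.head? = some st then lam ^ (h.1.length - 1) * probHist s0 σ h else 0)

/-- The expected `lam`-discounted time that the play spends in the set of states `D`. -/
def tSet (lam : ℝ) (s0 : G.S) (σ : G.Profile) (D : Finset G.S) : ℝ :=
  ∑ st : G.Step, if st.1 ∈ D then tStep lam s0 σ st else 0

/-- The `lam`-discounted (unnormalized) payoff `U^i_lam(s0,σ;D)` that player `i` receives
while the play is in `D`. -/
def UD (lam : ℝ) (s0 : G.S) (σ : G.Profile) (i : G.I) (D : Finset G.S) : ℝ :=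
  ∑ st : G.Step, if st.1 ∈ D then tStep lam s0 σ st * G.u i st.1 st.2 else 0

/-- The `lam`-discounted payoff of player `i`. -/
def payoffD (lam : ℝ) (s0 : G.S) (σ : G.Profile) (i : G.I) : ℝ :=
  ∑ st : G.Step, tStep lam s0 σ st * G.u i st.1 st.2

/-- `Di` is a partition of the set of states. -/
def IsPartitionF (Di : Finset (Finset G.S)) : Prop :=
  ∀ s : G.S, ∃! D : Finset G.S, D ∈ Di ∧ s ∈ D

/-- The payoff of player `i` in the modified game, given the partition `Di` and
the cutoffs `c`. -/
def modPayoff (lam : ℝ) (s0 : G.S) (σ : G.Profile) (i : G.I)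
    (Di : Finset (Finset G.S)) (c : Finset G.S → ℝ) : ℝ :=
  ∑ D ∈ Di, min (UD lam s0 σ i D) (tSet lam s0 σ D * c D)

/-- The `lam`-discounted min-max value of player `i` in the original game. -/
def minmaxOrig (G : StocGame) (lam : ℝ) (s0 : G.S) (i : G.I) : ℝ :=
  ⨅ σ : G.Profile, ⨆ σi : G.BStrat i, payoffD lam s0 (Function.update σ i σi) i

/-- The `lam`-discounted max-min value of player `i` in the original game. -/
def maxminOrig (G : StocGame) (lam : ℝ) (s0 : G.S) (i : G.I) : ℝ :=
  ⨆ σi : G.BStrat i, ⨅ σ : G.Profile, payoffD lam s0 (Function.update σ i σi) i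

/-- The min-max value of player `i` in the modified game. -/
def minmaxMod (G : StocGame) (lam : ℝ) (s0 : G.S) (i : G.I)
    (Di : Finset (Finset G.S)) (c : Finset G.S → ℝ) : ℝ :=
  ⨅ σ : G.Profile, ⨆ σi : G.BStrat i,
    modPayoff lam s0 (Function.update σ i σi) i Di c

/-- The max-min value of player `i` in the modified game. -/
def maxminMod (G : StocGame) (lam : ℝ) (s0 : G.S) (i : G.I)
    (Di : Finset (Finset G.S)) (c : Finset G.S → ℝ) : ℝ :=
  ⨆ σi : G.BStrat i, ⨅ σ : G.Profile,
    modPayoff lam s0 (Function.update σ i σi) i Di c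

/-- The min-max value in stationary strategies of player `i` in the modified game. -/
def minmaxModStat (G : StocGame) (lam : ℝ) (s0 : G.S) (i : G.I)
    (Di : Finset (Finset G.S)) (c : Finset G.S → ℝ) : ℝ :=
  ⨅ x : G.StatProf, ⨆ xi : G.Stat i,
    modPayoff lam s0 (Function.update (toB x) i (toB1 xi)) i Di c

/-- The max-min value in stationary strategies of player `i` in the modified game. -/
def maxminModStat (G : StocGame) (lam : ℝ) (s0 : G.S) (i : G.I)
    (Di : Finset (Finset G.S)) (c : Finset G.S → ℝ) : ℝ :=
  ⨆ xi : G.Stat i, ⨅ x : G.StatProf,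
    modPayoff lam s0 (Function.update (toB x) i (toB1 xi)) i Di c

/-! ### Plays and the induced measure -/

/-- A play: the infinite sequence of (state, action profile) pairs. -/
abbrev Play (G : StocGame) : Type := ℕ → G.Step

instance : MeasurableSpace G.Step := ⊤

/-- The finite history consisting of the first `n` stages of the play `p`
(reversed list of the first `n` steps, together with the state at stage `n`). -/
def histOf (p : G.Play) : ℕ → G.Hist
  | 0 => ([], (p 0).1)
  | n + 1 => ((p n) :: (histOf p n).1, (p (n + 1)).1)

/-- The cylinder set of plays whose initial segment is the finite history `h`. -/
def cylSet (h : G.Hist) : Set G.Play := {p | histOf p h.1.length = h}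

/-- `μfam` is the family of probability measures on plays induced (via the
Ionescu–Tulcea theorem) by the initial state and the strategy profile:
it is characterized by being a probability measure giving each cylinder set
the probability of the corresponding finite history. -/
def IsInduced (μfam : G.S → G.Profile → Measure G.Play) : Prop :=
  (∀ s0 σ, IsProbabilityMeasure (μfam s0 σ)) ∧
  ∀ (s0 : G.S) (σ : G.Profile) (h : G.Hist),
    μfam s0 σ (cylSet h) = ENNReal.ofReal (probHist s0 σ h)

/-- A bounded stopping time (with respect to the filtration generated by finite histories). -/
def IsBddST (τ : G.Play → ℕ) : Prop :=
  (∃ B, ∀ p, τ p ≤ B) ∧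
  ∀ p p' n, τ p = n → histOf p n = histOf p' n → τ p' = n

/-- Two states lie in the same element of the partition `Di`. -/
def sameOf (Di : Finset (Finset G.S)) (s s' : G.S) : Prop := ∃ D ∈ Di, s ∈ D ∧ s' ∈ D

open Classical in
/-- The number of switches between elements of a partition along a play,
where the partition is described through the relation `r` ("being in the same element"). -/
def Zsw (r : G.S → G.S → Prop) (p : G.Play) : ℝ≥0∞ :=
  ∑' n : ℕ, if r (p n).1 (p (n + 1)).1 then 0 else 1

/-- The stopping times `τ^𝒟_k` indicating when the play moves from one element of
the partition (described by the relation `r`) to another. -/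
def switchT (r : G.S → G.S → Prop) (p : G.Play) : ℕ → ℕ∞
  | 0 => 0
  | k + 1 => sInf {n : ℕ∞ | ∃ m : ℕ, n = (m : ℕ∞) ∧ switchT r p k < (m : ℕ∞) ∧
      ¬ r (p (m - 1)).1 (p m).1}

/-- The expected average payoff of player `i` in the `N`-stage game. -/
def payoffN (μfam : G.S → G.Profile → Measure G.Play) (N : ℕ) (s0 : G.S)
    (σ : G.Profile) (i : G.I) : ℝ :=
  (∫ p, (∑ n ∈ Finset.range N, G.u i (p n).1 (p n).2) ∂(μfam s0 σ)) / N

/-- `σi` is a uniform `ε`-max-min strategy of player `i` (with respect to the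
uniform max-min value function `v`). -/
def UnifMaxMin (μfam : G.S → G.Profile → Measure G.Play) (v : G.S → ℝ) (i : G.I)
    (σi : G.BStrat i) (ε : ℝ) : Prop :=
  ∃ lam0 : ℝ, 0 ≤ lam0 ∧ lam0 < 1 ∧ ∃ N0 : ℕ,
    ∀ (s0 : G.S) (σ : G.Profile),
      (∀ lam : ℝ, lam0 < lam → lam < 1 →
        v s0 - ε ≤ payoffD lam s0 (Function.update σ i σi) i) ∧
      (∀ τ : G.Play → ℕ, IsBddST τ →
        (N0 : ℝ) ≤ ∫ p, (τ p : ℝ) ∂(μfam s0 (Function.update σ i σi)) →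
        (v s0 - ε) * ∫ p, (τ p : ℝ) ∂(μfam s0 (Function.update σ i σi)) ≤
          ∫ p, (∑ n ∈ Finset.range (τ p), G.u i (p n).1 (p n).2)
            ∂(μfam s0 (Function.update σ i σi)))

/-- `σi` is `(𝒟,ε)`-max-min preserving, where the partition `𝒟` is described by the
relation `r`, and the conditional-expectation requirement is expressed through
integrals over the atoms (cylinder sets) of the σ-algebra of the stopping time `τ^𝒟_k`. -/
def PreservingPart (μfam : G.S → G.Profile → Measure G.Play) (v : G.S → ℝ)
    (r : G.S → G.S → Prop) (i : G.I) (σi : G.BStrat i) (ε : ℝ) : Prop :=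
  ∀ (s0 : G.S) (σ : G.Profile) (k : ℕ) (τ' : G.Play → ℕ), IsBddST τ' →
    (∀ p, switchT r p k ≠ ⊤ →
      switchT r p k < (τ' p : ℕ∞) ∧ (τ' p : ℕ∞) ≤ switchT r p (k + 1)) →
    ∀ h : G.Hist, (∀ p ∈ cylSet h, switchT r p k = (h.1.length : ℕ∞)) →
      ∫ p in cylSet h, (v h.2 - ε) ∂(μfam s0 (Function.update σ i σi)) ≤
        ∫ p in cylSet h, v ((p (τ' p)).1) ∂(μfam s0 (Function.update σ i σi))

/-- `σi` is `ε`-max-min preserving (with respect to arbitrary bounded stopping times);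
again the conditional-expectation requirement is expressed through integrals over the
atoms of the σ-algebra of the stopping time `τ`. -/
def PreservingST (μfam : G.S → G.Profile → Measure G.Play) (v : G.S → ℝ) (i : G.I)
    (σi : G.BStrat i) (ε : ℝ) : Prop :=
  ∀ (s0 : G.S) (σ : G.Profile) (τ τ' : G.Play → ℕ), IsBddST τ → IsBddST τ' →
    (∀ p, τ p < τ' p) →
    ∀ h : G.Hist, (∀ p ∈ cylSet h, τ p = h.1.length) →
      ∫ p in cylSet h, (v h.2 - ε) ∂(μfam s0 (Function.update σ i σi)) ≤
        ∫ p in cylSet h, v ((p (τ' p)).1) ∂(μfam s0 (Function.update σ i σi))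

/-- A history enters a new element of the partition (described by `r`) at its final stage. -/
def entersNew (r : G.S → G.S → Prop) (h : G.Hist) : Prop :=
  match h.1 with
  | [] => True
  | st :: _ => ¬ r st.1 h.2

/-- `σi` is `𝒟`-Markovian: its continuation strategy coincides after any two finite histories
that end at the same state and whose final stage enters a new element of the partition
(described by `r`). -/
def Markovian (r : G.S → G.S → Prop) {i : G.I} (σi : G.BStrat i) : Prop :=
  ∀ h h' : G.Hist, h.2 = h'.2 → entersNew r h → entersNew r h' →
    ∀ (l : List G.Step) (s'' : G.S), σi (l ++ h.1, s'') = σi (l ++ h'.1, s'')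

open Classical in
/-- The portion of the history since the last time the play entered a new element of the
partition (described by `r`): (reversed) list of steps, given the current state. -/
def philist (r : G.S → G.S → Prop) : List G.Step → G.S → List G.Step
  | [], _ => []
  | st :: rest, s => if r st.1 s then st :: philist r rest st.1 else []

/-- The restart strategy `σ^i_𝒟`: whenever the play enters a new element of the partition
(described by `r`), player `i` forgets past play and restarts playing `σi`. -/
def restart {i : G.I} (σi : G.BStrat i) (r : G.S → G.S → Prop) : G.BStrat i :=
  fun h => σi (philist r h.1 h.2, h.2)

/-- The partition `Di` satisfies Property P with respect to player `i`
(whose uniform max-min value function is `v`). -/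
def PropertyP (μfam : G.S → G.Profile → Measure G.Play) (v : G.S → ℝ) (i : G.I)
    (Di : Finset (Finset G.S)) : Prop :=
  ∃ ζ : ℝ, 0 < ζ ∧ ∀ ε : ℝ, 0 < ε → ∃ σi : G.BStrat i,
    Markovian (sameOf Di) σi ∧ UnifMaxMin μfam v i σi ε ∧
    ∀ (s0 : G.S) (σ : G.Profile), ∃ E : Set G.Play,
      ENNReal.ofReal (1 - ε) < μfam s0 (Function.update σ i σi) E ∧
      ∫⁻ p in E, Zsw (sameOf Di) p ∂(μfam s0 (Function.update σ i σi)) ≤ ENNReal.ofReal ζ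

/-- The strategy profile `σ` (whose `i`-th coordinate is the strategy of player `i`) makes
player `i`'s strategy a uniform `𝒟`-subgame-perfect `ε`-min-max strategy against the others'
strategies, at the initial state `s0`; `vbar` is the uniform min-max value function of
player `i`, and the partition `𝒟` is described by the relation `r`.  Conditional-expectation
requirements are expressed through integrals over the atoms (cylinder sets) of the σ-algebra
of the stopping time `τ^𝒟_k`. -/
def SubgamePerfect (μfam : G.S → G.Profile → Measure G.Play) (vbar : G.S → ℝ)
    (r : G.S → G.S → Prop) (i : G.I) (σ : G.Profile) (s0 : G.S) (ε : ℝ) : Prop :=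
  ∃ N0 : ℕ, 0 < N0 ∧
    (∀ N : ℕ, N0 ≤ N → vbar s0 - ε ≤ payoffN μfam N s0 σ i) ∧
    (∀ (k : ℕ) (τ : G.Play → ℕ), IsBddST τ → (∀ p, switchT r p k ≤ (τ p : ℕ∞)) →
      ∀ h : G.Hist, (∀ p ∈ cylSet h, switchT r p k = (h.1.length : ℕ∞)) →
        (∫ p in cylSet h, (vbar h.2 - ε) ∂(μfam s0 σ) ≤
          ∫ p in cylSet h, vbar ((p (τ p)).1) ∂(μfam s0 σ)) ∧
        ((N0 : ℝ) * (μfam s0 σ (cylSet h)).toReal ≤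
            ∫ p in cylSet h, ((τ p : ℝ) - (h.1.length : ℝ)) ∂(μfam s0 σ) →
          (vbar h.2 - ε) * ∫ p in cylSet h, ((τ p : ℝ) - (h.1.length : ℝ)) ∂(μfam s0 σ) ≤
            ∫ p in cylSet h, (∑ n ∈ Finset.Ico h.1.length (τ p), G.u i (p n).1 (p n).2)
              ∂(μfam s0 σ)))

/-- The partition `Di` satisfies Property P' with respect to player `i`
(whose uniform min-max value function is `vbar`). -/
def PropertyP' (μfam : G.S → G.Profile → Measure G.Play) (vbar : G.S → ℝ) (i : G.I)
    (Di : Finset (Finset G.S)) : Prop :=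
  ∃ ζ : ℝ, 0 < ζ ∧ ∀ ε : ℝ, 0 < ε → ∀ (s0 : G.S) (σ : G.Profile), ∃ σi : G.BStrat i,
    SubgamePerfect μfam vbar (sameOf Di) i (Function.update σ i σi) s0 ε ∧
    ∃ E : Set G.Play,
      ENNReal.ofReal (1 - ε) ≤ μfam s0 (Function.update σ i σi) E ∧
      ∫⁻ p in E, Zsw (sameOf Di) p ∂(μfam s0 (Function.update σ i σi)) ≤ ENNReal.ofReal ζ

/-! ### Reachability, closed and strongly controllable sets -/

/-- The first arrival time to the set of states `C`. -/
def hitT (C : Set G.S) (p : G.Play) : ℕ∞ :=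
  sInf {n : ℕ∞ | ∃ m : ℕ, n = (m : ℕ∞) ∧ (p m).1 ∈ C}

/-- State `s` leads in `D` to state `s'`. -/
def LeadsIn (μfam : G.S → G.Profile → Measure G.Play) (D : Set G.S) (s s' : G.S) : Prop :=
  ∃ σ : G.Profile, μfam s σ {p | hitT {s'} p < hitT Dᶜ p} = 1

/-- The states `s` and `s'` are `D`-siblings. -/
def Siblings (μfam : G.S → G.Profile → Measure G.Play) (D : Set G.S) (s s' : G.S) : Prop :=
  LeadsIn μfam D s s' ∧ LeadsIn μfam D s' s

/-- The probability `q(D | s, a)` that the next state lies in `D`. -/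
def qOf (D : Set G.S) (s : G.S) (a : G.Prof s) : ℝ := ∑ s', D.indicator (G.q s a) s'

/-- The set of states `D` is closed. -/
def ClosedSet (G : StocGame) (D : Set G.S) : Prop :=
  ∀ s ∈ D, ∀ a : G.Prof s, qOf D s a = 1

/-- The set of states `D` is strongly controllable. -/
def StronglyContr (G : StocGame) (D : Set G.S) : Prop :=
  ∃ iD : G.I, ∃ sD ∈ D, ∃ atil : G.A iD sD,
    ∀ s ∈ D, ∀ a : G.Prof s, qOf D s a < 1 → s = sD ∧ HEq (a iD) atil

/-- The element of the partition `𝒟` (by the vector of uniform min-max values `v`)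
that contains the state `s`. -/
def Dv (v : G.I → G.S → ℝ) (s : G.S) : Set G.S := {s' | ∀ i, v i s' = v i s}

/-- The element of the refined partition `𝒟*` (refining `𝒟` by the `D`-siblings relation)
that contains the state `s`. -/
def DstarCl (μfam : G.S → G.Profile → Measure G.Play) (v : G.I → G.S → ℝ) (s : G.S) :
    Set G.S := {s' | s' ∈ Dv v s ∧ Siblings μfam (Dv v s) s s'}

/-- The stochastic game is strongly controllable: every element of `𝒟*` is either closed
or strongly controllable. -/
def StronglyControllableGame (G : StocGame) (μfam : G.S → G.Profile → Measure G.Play)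
    (v : G.I → G.S → ℝ) : Prop :=
  ∀ s : G.S, ClosedSet G (DstarCl μfam v s) ∨ StronglyContr G (DstarCl μfam v s)

end StocGame

/-- A set `X ⊆ ℝ^ι` is monovex if every two points of `X` are connected by a continuous
path inside `X` all of whose coordinates are monotone. -/
def Monovex {ι : Type} (X : Set (ι → ℝ)) : Prop :=
  ∀ x ∈ X, ∀ y ∈ X, ∃ f : ℝ → ι → ℝ,
    ContinuousOn f (Set.Icc 0 1) ∧ (∀ t ∈ Set.Icc (0 : ℝ) 1, f t ∈ X) ∧
    f 0 = x ∧ f 1 = y ∧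
    ∀ j : ι, MonotoneOn (fun t => f t j) (Set.Icc 0 1) ∨
      AntitoneOn (fun t => f t j) (Set.Icc 0 1)

end

noncomputable section

namespace StocGame

variable {G : StocGame}

/-- The probability that the mixed actions `m` produce the action profile `a`. -/
def pProb {s : G.S} (m : (j : G.I) → Mixed (G.A j s)) (a : G.Prof s) : ℝ := ∏ j, (m j).1 (a j)

lemma pProb_nonneg {s : G.S} (m : (j : G.I) → Mixed (G.A j s)) (a : G.Prof s) :
    0 ≤ pProb m a :=
  Finset.prod_nonneg fun j _ => (m j).2.1 (a j)

lemma sum_pProb {s : G.S} (m : (j : G.I) → Mixed (G.A j s)) :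
    ∑ a : G.Prof s, pProb m a = 1 := by
  have h := Finset.prod_univ_sum (fun j : G.I => (Finset.univ : Finset (G.A j s)))
    (fun j a => (m j).1 a)
  rw [Fintype.piFinset_univ] at h
  unfold pProb
  rw [← h]
  exact Finset.prod_eq_one fun j _ => (m j).2.2

/-- The expectation, over the next action profile and the next state, of a function of
histories, given the current history. -/
def stepE (σ : G.Profile) (F : G.Hist → ℝ) (h : G.Hist) : ℝ :=
  ∑ a : G.Prof h.2, pProb (fun j => σ j h) a * ∑ s', G.q h.2 a s' * F (⟨h.2, a⟩ :: h.1, s')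

/-- The expectation of a function of the history of length `n`. -/
def expN (σ : G.Profile) (s : G.S) : ℕ → (G.Hist → ℝ) → ℝ
  | 0, F => F ([], s)
  | n + 1, F => expN σ s n (stepE σ F)

lemma stepE_mono (σ : G.Profile) {F F' : G.Hist → ℝ} {h : G.Hist}
    (H : ∀ a s', F (⟨h.2, a⟩ :: h.1, s') ≤ F' (⟨h.2, a⟩ :: h.1, s')) :
    stepE σ F h ≤ stepE σ F' h :=
  Finset.sum_le_sum fun a _ => mul_le_mul_of_nonneg_left
    (Finset.sum_le_sum fun s' _ => mul_le_mul_of_nonneg_left (H a s') (G.q_nonneg _ _ _))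
    (pProb_nonneg _ _)

lemma stepE_congr (σ : G.Profile) {F F' : G.Hist → ℝ} {h : G.Hist}
    (H : ∀ a s', F (⟨h.2, a⟩ :: h.1, s') = F' (⟨h.2, a⟩ :: h.1, s')) :
    stepE σ F h = stepE σ F' h := by
  unfold stepE; simp_rw [H]

lemma stepE_linear (σ : G.Profile) (F F' : G.Hist → ℝ) (x y : ℝ) :
    stepE σ (fun h => x * F h + y * F' h) = fun h => x * stepE σ F h + y * stepE σ F' h := by
  funext h
  simp only [stepE, Finset.mul_sum, ← Finset.sum_add_distrib]
  refine Finset.sum_congr rfl fun a _ => Finset.sum_congr rfl fun s' _ => ?_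
  ring

lemma stepE_const_mul (σ : G.Profile) (F : G.Hist → ℝ) (x : ℝ) (h : G.Hist) :
    stepE σ (fun h => x * F h) h = x * stepE σ F h := by
  have := congrFun (stepE_linear σ F F x 0) h
  simpa using this

lemma sum_pProb_q {s : G.S} (m : (j : G.I) → Mixed (G.A j s)) (x : ℝ) :
    ∑ a : G.Prof s, pProb m a * ∑ s', G.q s a s' * x = x := by
  simp_rw [← Finset.sum_mul, G.q_sum, one_mul]
  rw [← Finset.sum_mul, sum_pProb, one_mul]

lemma stepE_const (σ : G.Profile) (x : ℝ) : stepE σ (fun _ => x) = fun _ => x := by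
  funext h; exact sum_pProb_q _ x

lemma expN_mono (σ : G.Profile) (s : G.S) {n : ℕ} {F F' : G.Hist → ℝ}
    (H : ∀ h : G.Hist, h.1.length = n → F h ≤ F' h) : expN σ s n F ≤ expN σ s n F' := by
  induction n generalizing F F' with
  | zero => exact H _ rfl
  | succ n ih =>
    exact ih fun h hh => stepE_mono σ fun a s' => H _ (by simp [hh])

lemma expN_congr (σ : G.Profile) (s : G.S) {n : ℕ} {F F' : G.Hist → ℝ}
    (H : ∀ h : G.Hist, h.1.length = n → F h = F' h) : expN σ s n F = expN σ s n F' :=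
  le_antisymm (expN_mono σ s fun h hh => (H h hh).le) (expN_mono σ s fun h hh => (H h hh).ge)

lemma expN_linear (σ : G.Profile) (s : G.S) (n : ℕ) (F F' : G.Hist → ℝ) (x y : ℝ) :
    expN σ s n (fun h => x * F h + y * F' h) = x * expN σ s n F + y * expN σ s n F' := by
  induction n generalizing F F' with
  | zero => rfl
  | succ n ih => simp only [expN]; rw [stepE_linear, ih]

lemma expN_add (σ : G.Profile) (s : G.S) (n : ℕ) (F F' : G.Hist → ℝ) :
    expN σ s n (fun h => F h + F' h) = expN σ s n F + expN σ s n F' := by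
  simpa using expN_linear σ s n F F' 1 1

lemma expN_const_mul (σ : G.Profile) (s : G.S) (n : ℕ) (F : G.Hist → ℝ) (x : ℝ) :
    expN σ s n (fun h => x * F h) = x * expN σ s n F := by
  simpa using expN_linear σ s n F F x 0

lemma expN_const (σ : G.Profile) (s : G.S) (n : ℕ) (x : ℝ) : expN σ s n (fun _ => x) = x := by
  induction n with
  | zero => rfl
  | succ n ih => simp only [expN]; rw [stepE_const, ih]

lemma expN_sum {ι : Type*} (t : Finset ι) (σ : G.Profile) (s : G.S) (n : ℕ)
    (F : ι → G.Hist → ℝ) :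
    expN σ s n (fun h => ∑ k ∈ t, F k h) = ∑ k ∈ t, expN σ s n (F k) := by
  classical
  induction t using Finset.induction_on with
  | empty => simpa using expN_const σ s n 0
  | insert a t ha ih =>
    simp only [Finset.sum_insert ha]
    rw [expN_add, ih]

lemma expN_nonneg (σ : G.Profile) (s : G.S) {n : ℕ} {F : G.Hist → ℝ}
    (H : ∀ h : G.Hist, h.1.length = n → 0 ≤ F h) : 0 ≤ expN σ s n F := by
  have := expN_mono σ s (n := n) (F := fun _ => 0) (F' := F) H
  rwa [expN_const] at this

lemma abs_expN_le (σ : G.Profile) (s : G.S) {n : ℕ} {F : G.Hist → ℝ} {C : ℝ}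
    (H : ∀ h : G.Hist, h.1.length = n → |F h| ≤ C) : |expN σ s n F| ≤ C := by
  rw [abs_le]
  have h1 := expN_mono σ s (n := n) (F := fun _ => -C) (F' := F)
    fun h hh => (abs_le.1 (H h hh)).1
  have h2 := expN_mono σ s (n := n) (F := F) (F' := fun _ => C)
    fun h hh => (abs_le.1 (H h hh)).2
  rw [expN_const] at h1 h2
  exact ⟨h1, h2⟩

/-- The continuation of the strategy profile `σ` after the step `st`. -/
def shiftP (σ : G.Profile) (st : G.Step) : G.Profile := fun j h => σ j (h.1 ++ [st], h.2)

lemma expN_succ_first (σ : G.Profile) (s : G.S) (n : ℕ) (F : G.Hist → ℝ) :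
    expN σ s (n + 1) F = ∑ a : G.Prof s, pProb (fun j => σ j ([], s)) a *
      ∑ s', G.q s a s' * expN (shiftP σ ⟨s, a⟩) s' n (fun h => F (h.1 ++ [⟨s, a⟩], h.2)) := by
  induction n generalizing F with
  | zero => rfl
  | succ n ih =>
    rw [expN, ih]
    rfl

lemma sum_hist_probHist (σ : G.Profile) (s0 : G.S) (n : ℕ) (F : G.Hist → ℝ) :
    ∑ v : Fin n → G.Step, ∑ s, probHist s0 σ (List.ofFn v, s) * F (List.ofFn v, s) =
      expN σ s0 n F := by
  induction n generalizing F with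
  | zero =>
    simp [probHist, probHistAux, expN]
  | succ n ih =>
    rw [expN, ← ih (stepE σ F)]
    rw [← (Fin.consEquiv (fun _ : Fin (n + 1) => G.Step)).sum_comp, Fintype.sum_prod_type_right]
    refine Finset.sum_congr rfl fun v _ => ?_
    rw [Fintype.sum_sigma]
    refine Finset.sum_congr rfl fun s _ => ?_
    rw [stepE, Finset.mul_sum]
    refine Finset.sum_congr rfl fun a _ => ?_
    simp only [Finset.mul_sum]
    refine Finset.sum_congr rfl fun s' _ => ?_
    simp only [Fin.consEquiv, Equiv.coe_fn_mk, List.ofFn_cons, probHist, probHistAux, pProb]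
    ring

lemma probHist_nonneg (s0 : G.S) (σ : G.Profile) (h : G.Hist) : 0 ≤ probHist s0 σ h := by
  obtain ⟨l, s⟩ := h
  unfold probHist
  induction l generalizing s with
  | nil => simp only [probHistAux]; split_ifs <;> norm_num
  | cons st l ih =>
    obtain ⟨s', a⟩ := st
    simp only [probHistAux]
    exact mul_nonneg (mul_nonneg (ih s') (Finset.prod_nonneg fun j _ => (σ j (l, s')).2.1 _))
      (G.q_nonneg _ _ _)

/-- Histories, sorted by their length. -/
def histEquiv (G : StocGame) : G.Hist ≃ Σ n, (Fin n → G.Step) × G.S :=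
  (List.equivSigmaTuple.prodCongr (Equiv.refl G.S)).trans (Equiv.sigmaProdDistrib _ _)

lemma hasSum_hist (σ : G.Profile) (s0 : G.S) (F : G.Hist → ℝ) (hF : ∀ h, 0 ≤ F h)
    (hs : Summable fun n => expN σ s0 n F) :
    HasSum (fun h => probHist s0 σ h * F h) (∑' n, expN σ s0 n F) := by
  rw [← (histEquiv G).symm.hasSum_iff]
  have key : ∀ n, HasSum (fun c : (Fin n → G.Step) × G.S =>
      ((fun h => probHist s0 σ h * F h) ∘ (histEquiv G).symm) ⟨n, c⟩) (expN σ s0 n F) := by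
    intro n
    rw [← sum_hist_probHist, ← Fintype.sum_prod_type']
    exact hasSum_fintype _
  have hsum : Summable ((fun h => probHist s0 σ h * F h) ∘ (histEquiv G).symm) := by
    rw [summable_sigma_of_nonneg]
    · refine ⟨fun n => (key n).summable, ?_⟩
      convert hs using 2 with n
      exact (key n).tsum_eq
    · intro x
      exact mul_nonneg (probHist_nonneg _ _ _) (hF _)
  have := hsum.hasSum
  rwa [hsum.tsum_sigma' fun n => (key n).summable, tsum_congr fun n => (key n).tsum_eq] at this

/-- The expected value, given the current history, of a function of the current step. -/
def avgG (σ : G.Profile) (g : G.Step → ℝ) (h : G.Hist) : ℝ :=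
  ∑ a : G.Prof h.2, pProb (fun j => σ j h) a * g ⟨h.2, a⟩

lemma abs_avg_le {s : G.S} (m : (j : G.I) → Mixed (G.A j s)) {g : G.Prof s → ℝ} {C : ℝ}
    (hg : ∀ a, |g a| ≤ C) : |∑ a, pProb m a * g a| ≤ C := by
  refine (Finset.abs_sum_le_sum_abs _ _).trans ?_
  calc ∑ a, |pProb m a * g a| ≤ ∑ a, pProb m a * C := Finset.sum_le_sum fun a _ => by
        rw [abs_mul, abs_of_nonneg (pProb_nonneg m a)]
        exact mul_le_mul_of_nonneg_left (hg a) (pProb_nonneg m a)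
    _ = C := by rw [← Finset.sum_mul, sum_pProb, one_mul]

lemma abs_avgG_le (σ : G.Profile) {g : G.Step → ℝ} {C : ℝ} (hg : ∀ st, |g st| ≤ C)
    (h : G.Hist) : |avgG σ g h| ≤ C :=
  abs_avg_le _ fun _ => hg _

/-- The discounted payoff associated with a stage payoff function `g`. -/
def payG (lam : ℝ) (s0 : G.S) (σ : G.Profile) (g : G.Step → ℝ) : ℝ :=
  ∑ st : G.Step, tStep lam s0 σ st * g st

lemma summable_pow_mul {lam : ℝ} (h0 : 0 ≤ lam) (h1 : lam < 1) {r : ℕ → ℝ} {C : ℝ}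
    (hr : ∀ n, |r n| ≤ C) : Summable fun n => lam ^ n * r n := by
  refine Summable.of_norm_bounded ((summable_geometric_of_lt_one h0 h1).mul_right C) fun n => ?_
  rw [Real.norm_eq_abs, abs_mul, abs_of_nonneg (pow_nonneg h0 n)]
  exact mul_le_mul_of_nonneg_left (hr n) (pow_nonneg h0 n)

open Classical in
lemma tStep_hasSum {lam : ℝ} (h0 : 0 ≤ lam) (h1 : lam < 1) (s0 : G.S) (σ : G.Profile)
    (st : G.Step) :
    HasSum (fun h : G.Hist =>
      if h.1.head? = some st then lam ^ (h.1.length - 1) * probHist s0 σ h else 0)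
      (∑' n, lam ^ n * expN σ s0 n (avgG σ fun st' => if st' = st then 1 else 0)) := by
  set F : G.Hist → ℝ := fun h => if h.1.head? = some st then lam ^ (h.1.length - 1) else 0
  have hF0 : expN σ s0 0 F = 0 := by simp [expN, F]
  have hF : ∀ n, expN σ s0 (n + 1) F =
      lam ^ n * expN σ s0 n (avgG σ fun st' => if st' = st then 1 else 0) := by
    intro n
    rw [expN, ← expN_const_mul]
    refine expN_congr _ _ fun h hh => ?_
    unfold stepE avgG
    rw [Finset.mul_sum]
    refine Finset.sum_congr rfl fun a _ => ?_
    simp only [F, List.head?_cons, Option.some.injEq, List.length_cons, hh, Nat.add_sub_cancel]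
    rw [← Finset.sum_mul, G.q_sum]
    split_ifs <;> ring
  have hs' : Summable fun n => lam ^ n *
      expN σ s0 n (avgG σ fun st' => if st' = st then 1 else 0) :=
    summable_pow_mul h0 h1 (C := 1) fun n => abs_expN_le _ _ fun h _ =>
      abs_avgG_le _ (fun st' => by split_ifs <;> simp) h
  have hs : Summable fun n => expN σ s0 n F := by
    rw [← summable_nat_add_iff 1]
    simpa only [hF] using hs'
  have := hasSum_hist σ s0 F (fun h => by simp only [F]; split_ifs <;> positivity) hs
  rw [hs.tsum_eq_zero_add, hF0, zero_add, tsum_congr hF] at this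
  convert this using 2 with h
  simp only [F]
  split_ifs <;> ring

lemma tStep_eq {lam : ℝ} (h0 : 0 ≤ lam) (h1 : lam < 1) (s0 : G.S) (σ : G.Profile)
    (st : G.Step) : tStep lam s0 σ st = (1 - lam) *
      ∑' n, lam ^ n * expN σ s0 n (avgG σ fun st' => if st' = st then 1 else 0) := by
  rw [← (tStep_hasSum h0 h1 s0 σ st).tsum_eq, tStep]

lemma payG_eq {lam : ℝ} (h0 : 0 ≤ lam) (h1 : lam < 1) (s0 : G.S) (σ : G.Profile)
    (g : G.Step → ℝ) :
    payG lam s0 σ g = (1 - lam) * ∑' n, lam ^ n * expN σ s0 n (avgG σ g) := by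
  classical
  unfold payG
  simp_rw [tStep_eq h0 h1, mul_assoc]
  rw [← Finset.mul_sum]
  congr 1
  have hs : ∀ st : G.Step, Summable fun n => lam ^ n *
      expN σ s0 n (avgG σ fun st' => if st' = st then 1 else 0) := fun st =>
    summable_pow_mul h0 h1 (C := 1) fun n => abs_expN_le _ _ fun h _ =>
      abs_avgG_le _ (fun st' => by split_ifs <;> simp) h
  simp_rw [← tsum_mul_right]
  rw [← Summable.tsum_finsetSum fun st _ => (hs st).mul_right _]
  refine tsum_congr fun n => ?_
  simp_rw [mul_assoc]
  rw [← Finset.mul_sum]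
  congr 1
  simp_rw [mul_comm _ (g _), ← expN_const_mul]
  rw [← expN_sum]
  refine expN_congr _ _ fun h _ => ?_
  unfold avgG
  simp_rw [Finset.mul_sum]
  rw [Finset.sum_comm]
  refine Finset.sum_congr rfl fun a _ => ?_
  rw [Finset.sum_eq_single (⟨h.2, a⟩ : G.Step)]
  · simp; ring
  · intro b _ hb; rw [if_neg (Ne.symm hb)]; ring
  · simp

end StocGame

/-- A minimum of two linear functions can be replaced by a convex combination of them without
increasing the supremum, on a convex set, of its sum with a concave function. -/
lemma exists_convexComb_le {E : Type*} [AddCommGroup E] [Module ℝ E] {K : Set E}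
    (p r : E →ₗ[ℝ] ℝ) {k : E → ℝ} (hk : ConcaveOn ℝ K k) {b : ℝ}
    (H : ∀ x ∈ K, min (p x) (r x) + k x ≤ b) :
    ∃ α : ℝ, 0 ≤ α ∧ α ≤ 1 ∧ ∀ x ∈ K, α * p x + (1 - α) * r x + k x ≤ b := by
  set d : E → ℝ := fun x => p x - r x with hd
  set e : E → ℝ := fun x => b - k x - r x with he
  have H1 : ∀ x ∈ K, min (d x) 0 ≤ e x := by
    intro x hx
    have := H x hx
    rw [hd, he]
    simp only
    rcases le_total (p x) (r x) with h | h
    · rw [min_eq_left h] at this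
      exact (min_le_left _ _).trans (by linarith)
    · rw [min_eq_right h] at this
      exact (min_le_right _ _).trans (by linarith)
  set A : Set ℝ := insert 0 {z | ∃ y ∈ K, d y < 0 ∧ z = e y / d y} with hA
  have hA1 : ∀ z ∈ A, z ≤ 1 := by
    rintro z (rfl | ⟨y, hy, hdy, rfl⟩)
    · exact zero_le_one
    · have := H1 y hy
      rw [min_eq_left hdy.le] at this
      rw [div_le_one_of_neg hdy]; exact this
  have hbdd : BddAbove A := ⟨1, hA1⟩
  have hne : A.Nonempty := ⟨0, Set.mem_insert _ _⟩
  refine ⟨sSup A, le_csSup hbdd (Set.mem_insert _ _), csSup_le hne hA1, fun x hx => ?_⟩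
  suffices sSup A * d x ≤ e x by
    simp only [hd, he] at this; linarith
  rcases lt_trichotomy (d x) 0 with h | h | h
  · have : e x / d x ≤ sSup A := le_csSup hbdd (Or.inr ⟨x, hx, h, rfl⟩)
    rwa [div_le_iff_of_neg h] at this
  · have := H1 x hx
    rw [h] at this ⊢
    simpa using this
  · have hex : 0 ≤ e x := by simpa [min_eq_right h.le] using H1 x hx
    rw [← le_div_iff₀ h]
    refine csSup_le hne ?_
    rintro z (rfl | ⟨y, hy, hdy, rfl⟩)
    · positivity
    · rw [div_le_iff_of_neg hdy]
      have hs : 0 < d x - d y := by linarith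
      set a : ℝ := -d y / (d x - d y)
      set a' : ℝ := d x / (d x - d y)
      have ha : 0 ≤ a := div_nonneg (by linarith) hs.le
      have ha' : 0 ≤ a' := div_nonneg h.le hs.le
      have haa : a + a' = 1 := by simp only [a, a']; field_simp; ring
      have hz := H1 _ (hk.1 hx hy ha ha' haa)
      have hconc := hk.2 hx hy ha ha' haa
      have hdz : d (a • x + a' • y) = 0 := by
        simp only [hd, map_add, map_smul, smul_eq_mul]
        have : a * d x + a' * d y = 0 := by simp only [a, a']; field_simp; ring
        simp only [hd] at this
        linarith
      rw [hdz, min_self] at hz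
      have hez : e (a • x + a' • y) ≤ a * e x + a' * e y := by
        simp only [he, map_add, map_smul, smul_eq_mul] at hconc ⊢
        have : b = (a + a') * b := by rw [haa, one_mul]
        linarith
      have h3 : 0 ≤ (a * e x + a' * e y) * (d x - d y) := mul_nonneg (hz.trans hez) hs.le
      have h4 : (a * e x + a' * e y) * (d x - d y) = -d y * e x + d x * e y := by
        simp only [a, a']; field_simp
      rw [h4] at h3
      rw [div_mul_eq_mul_div, div_le_iff₀ h]
      linarith

/-- A sum of minima of pairs of linear functions can be linearized on a convex set. -/
lemma exists_convexComb_sum_le {E ι : Type*} [AddCommGroup E] [Module ℝ E] {K : Set E}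
    (t : Finset ι) (p r : ι → E →ₗ[ℝ] ℝ) {k : E → ℝ} (hk : ConcaveOn ℝ K k) {b : ℝ}
    (H : ∀ x ∈ K, ∑ D ∈ t, min (p D x) (r D x) + k x ≤ b) :
    ∃ α : ι → ℝ, (∀ D, 0 ≤ α D ∧ α D ≤ 1) ∧
      ∀ x ∈ K, ∑ D ∈ t, (α D * p D x + (1 - α D) * r D x) + k x ≤ b := by
  classical
  induction t using Finset.induction_on generalizing k with
  | empty => exact ⟨fun _ => 0, fun _ => by norm_num, by simpa using H⟩
  | insert a t ha ih =>
    have hmin : ConcaveOn ℝ K fun x => ∑ D ∈ t, min (p D x) (r D x) + k x := by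
      refine ConcaveOn.add ?_ hk
      clear H ih ha
      induction t using Finset.induction_on with
      | empty => simpa using concaveOn_const (0 : ℝ) hk.1
      | insert a t ha ih =>
        simp only [Finset.sum_insert ha]
        exact (((p a).concaveOn hk.1).inf ((r a).concaveOn hk.1)).add ih
    obtain ⟨α, h0, h1, hα⟩ := exists_convexComb_le (p a) (r a) hmin (b := b) fun x hx => by
      have := H x hx
      rw [Finset.sum_insert ha] at this
      linarith
    have hk' : ConcaveOn ℝ K fun x => (α • p a + (1 - α) • r a) x + k x :=
      ((α • p a + (1 - α) • r a).concaveOn hk.1).add hk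
    obtain ⟨β, hβ, hβ'⟩ := ih hk' fun x hx => by
      have := hα x hx
      simp only [LinearMap.add_apply, LinearMap.smul_apply, smul_eq_mul]
      linarith
    refine ⟨Function.update β a α, fun D => ?_, fun x hx => ?_⟩
    · by_cases hD : D = a
      · subst hD; simp [h0, h1]
      · simpa [hD] using hβ D
    · rw [Finset.sum_insert ha, Function.update_self]
      have := hβ' x hx
      simp only [LinearMap.add_apply, LinearMap.smul_apply, smul_eq_mul] at this
      rw [Finset.sum_congr rfl fun D hD => by
        rw [Function.update_of_ne (ne_of_mem_of_not_mem hD ha)]]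
      linarith

namespace StocGame

variable {G : StocGame}

lemma payG_first {lam : ℝ} (h0 : 0 ≤ lam) (h1 : lam < 1) (s : G.S) (σ : G.Profile)
    (g : G.Step → ℝ) :
    payG lam s σ g = ∑ a : G.Prof s, pProb (fun j => σ j ([], s)) a *
      ((1 - lam) * g ⟨s, a⟩ +
        lam * ∑ s', G.q s a s' * payG lam s' (shiftP σ ⟨s, a⟩) g) := by
  obtain ⟨C, hC⟩ : ∃ C, ∀ st, |g st| ≤ C :=
    ⟨∑ st, |g st|, fun st => Finset.single_le_sum (f := fun st => |g st|)
      (fun _ _ => abs_nonneg _) (Finset.mem_univ st)⟩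
  have hs : ∀ (s : G.S) (σ : G.Profile), Summable fun n => lam ^ n * expN σ s n (avgG σ g) :=
    fun s σ => summable_pow_mul h0 h1 (C := C) fun n => abs_expN_le _ _ fun h _ =>
      abs_avgG_le _ hC h
  rw [payG_eq h0 h1, (hs s σ).tsum_eq_zero_add]
  simp_rw [payG_eq h0 h1]
  have key : ∀ n, lam ^ (n + 1) * expN σ s (n + 1) (avgG σ g) =
      ∑ a : G.Prof s, ∑ s', pProb (fun j => σ j ([], s)) a * lam * G.q s a s' *
        (lam ^ n * expN (shiftP σ ⟨s, a⟩) s' n (avgG (shiftP σ ⟨s, a⟩) g)) := by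
    intro n
    rw [expN_succ_first, Finset.mul_sum]
    refine Finset.sum_congr rfl fun a _ => ?_
    rw [Finset.mul_sum, Finset.mul_sum]
    refine Finset.sum_congr rfl fun s' _ => ?_
    have : (fun h : G.Hist => avgG σ g (h.1 ++ [⟨s, a⟩], h.2)) =
      avgG (shiftP σ ⟨s, a⟩) g := rfl
    rw [this]
    ring
  rw [tsum_congr key, Summable.tsum_finsetSum fun a _ => summable_sum fun s' _ =>
    (hs s' _).mul_left _]
  simp_rw [Summable.tsum_finsetSum fun s' (_ : s' ∈ Finset.univ) =>
    (hs s' (shiftP σ _)).mul_left _, tsum_mul_left]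
  have h00 : lam ^ 0 * expN σ s 0 (avgG σ g) =
      ∑ a : G.Prof s, pProb (fun j => σ j ([], s)) a * g ⟨s, a⟩ := by simp [expN, avgG]
  rw [h00, ← Finset.sum_add_distrib, Finset.mul_sum]
  refine Finset.sum_congr rfl fun a _ => ?_
  rw [mul_add, mul_add, Finset.mul_sum, Finset.mul_sum, Finset.mul_sum]
  congr 1
  · ring
  · refine Finset.sum_congr rfl fun s' _ => ?_
    ring

/-- The contribution of player `i`'s strategy to the probability of a history. -/
def ownW {i : G.I} (σi : G.BStrat i) : List G.Step → ℝ
  | [] => 1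
  | ⟨s', a⟩ :: rest => ownW σi rest * (σi (rest, s')).1 (a i)

/-- The contribution of the opponents of player `i` and of nature to the probability of a
history. -/
def oppW (s0 : G.S) (σ : G.Profile) (i : G.I) : List G.Step → G.S → ℝ
  | [], s => if s = s0 then 1 else 0
  | ⟨s', a⟩ :: rest, s =>
      oppW s0 σ i rest s' * (∏ j ∈ Finset.univ.erase i, (σ j (rest, s')).1 (a j)) * G.q s' a s

lemma ownW_nonneg {i : G.I} (σi : G.BStrat i) (l : List G.Step) : 0 ≤ ownW σi l := by
  induction l with
  | nil => exact zero_le_one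
  | cons st l ih => exact mul_nonneg ih ((σi (l, st.1)).2.1 _)

lemma probHist_update (s0 : G.S) (σ : G.Profile) {i : G.I} (σi : G.BStrat i) (l : List G.Step)
    (s : G.S) :
    probHist s0 (Function.update σ i σi) (l, s) = ownW σi l * oppW s0 σ i l s := by
  unfold probHist
  induction l generalizing s with
  | nil => simp [probHistAux, ownW, oppW]
  | cons st l ih =>
    obtain ⟨s', a⟩ := st
    simp only [probHistAux, ownW, oppW] at ih ⊢
    rw [ih, ← Finset.mul_prod_erase _ _ (Finset.mem_univ i), Function.update_self,
      Finset.prod_congr rfl fun j hj => by rw [Function.update_of_ne (Finset.ne_of_mem_erase hj)]]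
    ring

open Classical in
/-- The behavior strategy equivalent to playing `σ1` with probability `θ` and `σ2` with
probability `1 - θ`. -/
def mixStrat {i : G.I} (θ : ℝ) (hθ : 0 ≤ θ ∧ θ ≤ 1) (σ1 σ2 : G.BStrat i) : G.BStrat i := fun h =>
  if hW : θ * ownW σ1 h.1 + (1 - θ) * ownW σ2 h.1 = 0 then σ1 h
  else ⟨fun a => (θ * ownW σ1 h.1 * (σ1 h).1 a + (1 - θ) * ownW σ2 h.1 * (σ2 h).1 a) /
      (θ * ownW σ1 h.1 + (1 - θ) * ownW σ2 h.1), by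
    have h1 := mul_nonneg hθ.1 (ownW_nonneg σ1 h.1)
    have h2 := mul_nonneg (sub_nonneg.2 hθ.2) (ownW_nonneg σ2 h.1)
    refine ⟨fun a => div_nonneg (add_nonneg (mul_nonneg h1 ((σ1 h).2.1 a))
      (mul_nonneg h2 ((σ2 h).2.1 a))) (add_nonneg h1 h2), ?_⟩
    rw [← Finset.sum_div, Finset.sum_add_distrib, ← Finset.mul_sum, ← Finset.mul_sum,
      (σ1 h).2.2, (σ2 h).2.2, mul_one, mul_one, div_self hW]⟩

lemma ownW_mixStrat {i : G.I} (θ : ℝ) (hθ : 0 ≤ θ ∧ θ ≤ 1) (σ1 σ2 : G.BStrat i)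
    (l : List G.Step) :
    ownW (mixStrat θ hθ σ1 σ2) l = θ * ownW σ1 l + (1 - θ) * ownW σ2 l := by
  induction l with
  | nil => simp [ownW]
  | cons st l ih =>
    obtain ⟨s', a⟩ := st
    simp only [ownW]
    rw [ih]
    unfold mixStrat
    have h1 := mul_nonneg hθ.1 (ownW_nonneg σ1 l)
    have h2 := mul_nonneg (sub_nonneg.2 hθ.2) (ownW_nonneg σ2 l)
    split_ifs with hW
    · have e1 : θ * ownW σ1 l = 0 := by linarith
      have e2 : (1 - θ) * ownW σ2 l = 0 := by linarith
      rw [hW, ← mul_assoc, ← mul_assoc, e1, e2]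
      ring
    · simp only
      rw [mul_div_cancel₀ _ hW]
      ring

lemma tStep_mixStrat {lam : ℝ} (h0 : 0 ≤ lam) (h1 : lam < 1) (s0 : G.S) (σ : G.Profile)
    {i : G.I} (θ : ℝ) (hθ : 0 ≤ θ ∧ θ ≤ 1) (σ1 σ2 : G.BStrat i) (st : G.Step) :
    tStep lam s0 (Function.update σ i (mixStrat θ hθ σ1 σ2)) st =
      θ * tStep lam s0 (Function.update σ i σ1) st +
        (1 - θ) * tStep lam s0 (Function.update σ i σ2) st := by
  classical
  have e1 := (tStep_hasSum h0 h1 s0 (Function.update σ i σ1) st).summable.hasSum.mul_left θ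
  have e2 := (tStep_hasSum h0 h1 s0 (Function.update σ i σ2) st).summable.hasSum.mul_left (1 - θ)
  have e3 := (e1.add e2).tsum_eq
  unfold tStep
  rw [show ∀ x y z : ℝ, θ * (x * y) + (1 - θ) * (x * z) = x * (θ * y + (1 - θ) * z) by
    intros; ring]
  congr 1
  convert e3 using 1
  refine tsum_congr fun h => ?_
  obtain ⟨l, s⟩ := h
  simp only [probHist_update, ownW_mixStrat]
  split_ifs <;> ring

/-- The element of the partition `Di` that contains `s`. -/
def partOf (Di : Finset (Finset G.S)) (hDi : IsPartitionF Di) (s : G.S) : Finset G.S :=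
  (hDi s).choose

lemma partOf_mem {Di : Finset (Finset G.S)} (hDi : IsPartitionF Di) (s : G.S) :
    partOf Di hDi s ∈ Di ∧ s ∈ partOf Di hDi s :=
  (hDi s).choose_spec.1

lemma eq_partOf {Di : Finset (Finset G.S)} (hDi : IsPartitionF Di) {s : G.S} {D : Finset G.S}
    (hD : D ∈ Di) (hs : s ∈ D) : D = partOf Di hDi s :=
  (hDi s).choose_spec.2 D ⟨hD, hs⟩

lemma partOf_eq_of_sameOf {Di : Finset (Finset G.S)} (hDi : IsPartitionF Di) {s s' : G.S}
    (h : sameOf Di s s') : partOf Di hDi s = partOf Di hDi s' := by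
  obtain ⟨D, hD, h1, h2⟩ := h
  rw [← eq_partOf hDi hD h1, eq_partOf hDi hD h2]

/-- The stage payoff that mixes the payoff of player `i` and the cutoff. -/
def mixPay (Di : Finset (Finset G.S)) (hDi : IsPartitionF Di) (c : Finset G.S → ℝ) (i : G.I)
    (α : Finset G.S → ℝ) (st : G.Step) : ℝ :=
  α (partOf Di hDi st.1) * G.u i st.1 st.2 +
    (1 - α (partOf Di hDi st.1)) * c (partOf Di hDi st.1)

lemma exists_linearization {lam : ℝ} (h0 : 0 ≤ lam) (h1 : lam < 1) (s0 : G.S) (σ : G.Profile)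
    (i : G.I) {Di : Finset (Finset G.S)} (hDi : IsPartitionF Di) (c : Finset G.S → ℝ) {b : ℝ}
    (H : ∀ σi : G.BStrat i, modPayoff lam s0 (Function.update σ i σi) i Di c ≤ b) :
    ∃ α : Finset G.S → ℝ, (∀ D, 0 ≤ α D ∧ α D ≤ 1) ∧ ∀ σi : G.BStrat i,
      payG lam s0 (Function.update σ i σi) (mixPay Di hDi c i α) ≤ b := by
  classical
  let K : Set (G.Step → ℝ) :=
    Set.range fun σi : G.BStrat i => tStep lam s0 (Function.update σ i σi)
  have hK : Convex ℝ K := by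
    rintro _ ⟨σ1, rfl⟩ _ ⟨σ2, rfl⟩ a a' ha ha' haa
    obtain rfl : a' = 1 - a := by linarith
    refine ⟨mixStrat a ⟨ha, by linarith⟩ σ1 σ2, ?_⟩
    funext st
    simp only [tStep_mixStrat h0 h1, Pi.add_apply, Pi.smul_apply, smul_eq_mul]
  let p : Finset G.S → (G.Step → ℝ) →ₗ[ℝ] ℝ := fun D =>
    ∑ st : G.Step, (if st.1 ∈ D then G.u i st.1 st.2 else 0) • LinearMap.proj st
  let r : Finset G.S → (G.Step → ℝ) →ₗ[ℝ] ℝ := fun D =>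
    ∑ st : G.Step, (if st.1 ∈ D then c D else 0) • LinearMap.proj st
  have hp : ∀ D t, p D t = ∑ st, if st.1 ∈ D then t st * G.u i st.1 st.2 else 0 := by
    intro D t
    simp only [p, LinearMap.sum_apply, LinearMap.smul_apply, LinearMap.proj_apply, smul_eq_mul]
    refine Finset.sum_congr rfl fun st _ => ?_
    split_ifs <;> ring
  have hr : ∀ D t, r D t = (∑ st : G.Step, if st.1 ∈ D then t st else 0) * c D := by
    intro D t
    simp only [r, LinearMap.sum_apply, LinearMap.smul_apply, LinearMap.proj_apply, smul_eq_mul,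
      Finset.sum_mul]
    refine Finset.sum_congr rfl fun st _ => ?_
    split_ifs <;> ring
  obtain ⟨α, hα, hα'⟩ := exists_convexComb_sum_le Di p r (concaveOn_const (0 : ℝ) hK) (b := b) (by
    rintro _ ⟨σi, rfl⟩
    simp only [hp, hr, add_zero]
    exact H σi)
  refine ⟨α, hα, fun σi => le_of_eq_of_le ?_ (hα' _ ⟨σi, rfl⟩)⟩
  simp only [hp, hr, add_zero, Finset.sum_mul, Finset.mul_sum, ← Finset.sum_add_distrib]
  rw [Finset.sum_comm, payG]
  refine Finset.sum_congr rfl fun st _ => ?_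
  obtain ⟨hm, hs⟩ := partOf_mem hDi st.1
  rw [Finset.sum_eq_single (partOf Di hDi st.1)]
  · simp only [hs, if_true, mixPay]; ring
  · intro D hD hne
    have : st.1 ∉ D := fun h => hne (eq_partOf hDi hD h)
    simp [this]
  · exact fun h => absurd hm h

lemma abs_payG_le {lam : ℝ} (h0 : 0 ≤ lam) (h1 : lam < 1) (s : G.S) (σ : G.Profile)
    {g : G.Step → ℝ} {C : ℝ} (hg : ∀ st, |g st| ≤ C) : |payG lam s σ g| ≤ C := by
  have hb : ∀ n, |expN σ s n (avgG σ g)| ≤ C := fun n =>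
    abs_expN_le _ _ fun h _ => abs_avgG_le _ hg h
  rw [payG_eq h0 h1, abs_mul, abs_of_pos (sub_pos.2 h1)]
  have hgeo := (hasSum_geometric_of_lt_one h0 h1).mul_right C
  have : |∑' n, lam ^ n * expN σ s n (avgG σ g)| ≤ (1 - lam)⁻¹ * C := by
    rw [← Real.norm_eq_abs]
    refine tsum_of_norm_bounded hgeo fun n => ?_
    rw [Real.norm_eq_abs, abs_mul, abs_of_nonneg (pow_nonneg h0 n)]
    exact mul_le_mul_of_nonneg_left (hb n) (pow_nonneg h0 n)
  calc (1 - lam) * |∑' n, lam ^ n * expN σ s n (avgG σ g)| ≤ (1 - lam) * ((1 - lam)⁻¹ * C) :=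
        mul_le_mul_of_nonneg_left this (sub_pos.2 h1).le
    _ = C := by rw [← mul_assoc, mul_inv_cancel₀ (sub_pos.2 h1).ne', one_mul]

lemma exists_abs_le (g : G.Step → ℝ) : ∃ C, ∀ st, |g st| ≤ C :=
  ⟨∑ st, |g st|, fun st => Finset.single_le_sum (f := fun st => |g st|)
    (fun _ _ => abs_nonneg _) (Finset.mem_univ st)⟩

/-- The initial state of a history. -/
def initS : List G.Step → G.S → G.S
  | [], s => s
  | ⟨s', _⟩ :: rest, _ => initS rest s'

lemma expN_congr_init (σ : G.Profile) (s : G.S) {n : ℕ} {F F' : G.Hist → ℝ}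
    (H : ∀ h : G.Hist, initS h.1 h.2 = s → F h = F' h) : expN σ s n F = expN σ s n F' := by
  induction n generalizing F F' with
  | zero => exact H _ rfl
  | succ n ih =>
    exact ih fun h hh => stepE_congr σ fun a s' => H _ (by simpa [initS] using hh)

lemma expN_profile_congr {σ σ' : G.Profile} {s : G.S} (n : ℕ) (F : G.Hist → ℝ)
    (H : ∀ h : G.Hist, initS h.1 h.2 = s → ∀ j, σ j h = σ' j h) :
    expN σ s n F = expN σ' s n F := by
  induction n generalizing F with
  | zero => rfl
  | succ n ih =>
    rw [expN, expN, ih]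
    exact expN_congr_init _ _ fun h hh => by simp [stepE, H h hh]

lemma payG_profile_congr {lam : ℝ} (h0 : 0 ≤ lam) (h1 : lam < 1) {σ σ' : G.Profile} {s : G.S}
    (g : G.Step → ℝ) (H : ∀ h : G.Hist, initS h.1 h.2 = s → ∀ j, σ j h = σ' j h) :
    payG lam s σ g = payG lam s σ' g := by
  rw [payG_eq h0 h1, payG_eq h0 h1]
  congr 1
  refine tsum_congr fun n => ?_
  rw [expN_profile_congr n _ H]
  congr 1
  exact expN_congr_init _ _ fun h hh => by simp [avgG, H h hh]

/-- The best-reply value of player `i` against the opponents' part of `σ`. -/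
def brV (lam : ℝ) (i : G.I) (σ : G.Profile) (g : G.Step → ℝ) (s : G.S) : ℝ :=
  ⨆ σi : G.BStrat i, payG lam s (Function.update σ i σi) g

lemma brV_bdd {lam : ℝ} (h0 : 0 ≤ lam) (h1 : lam < 1) (i : G.I) (σ : G.Profile)
    (g : G.Step → ℝ) (s : G.S) :
    BddAbove (Set.range fun σi : G.BStrat i => payG lam s (Function.update σ i σi) g) := by
  obtain ⟨C, hC⟩ := exists_abs_le g
  exact ⟨C, by rintro _ ⟨σi, rfl⟩; exact (abs_le.1 (abs_payG_le h0 h1 s _ hC)).2⟩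

lemma abs_brV_le {lam : ℝ} (h0 : 0 ≤ lam) (h1 : lam < 1) (i : G.I) (σ : G.Profile)
    {g : G.Step → ℝ} {C : ℝ} (hC : ∀ st, |g st| ≤ C) (s : G.S) : |brV lam i σ g s| ≤ C := by
  have : Nonempty (G.BStrat i) := ⟨σ i⟩
  rw [abs_le]
  constructor
  · exact (abs_le.1 (abs_payG_le h0 h1 s _ hC)).1.trans (le_ciSup (brV_bdd h0 h1 i σ g s) (σ i))
  · exact ciSup_le fun σi => (abs_le.1 (abs_payG_le h0 h1 s _ hC)).2

/-- The strategy that plays `first` at the initial stage, and then follows `ρ st s'`,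
where `st` is the first step and `s'` the second state. -/
def replyS {i : G.I} (first : G.Stat i) (ρ : G.Step → G.S → G.BStrat i) : G.BStrat i := fun h =>
  if hl : h.1 = [] then first h.2
  else ρ (h.1.getLast hl) (initS h.1.dropLast h.2) (h.1.dropLast, h.2)

lemma replyS_append {i : G.I} (first : G.Stat i) (ρ : G.Step → G.S → G.BStrat i)
    (l : List G.Step) (st : G.Step) (s : G.S) :
    replyS first ρ (l ++ [st], s) = ρ st (initS l s) (l, s) := by
  have h : ∀ (st' : G.Step) (l' : List G.Step), st' = st → l' = l →
      (ρ st' (initS l' s) (l', s) : Mixed (G.A i s)) = ρ st (initS l s) (l, s) := by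
    rintro _ _ rfl rfl; rfl
  have hl : l ++ [st] ≠ [] := by simp
  unfold replyS
  rw [dif_neg hl]
  exact h _ _ (by simp) (by simp)

lemma one_step {lam : ℝ} (h0 : 0 ≤ lam) (h1 : lam < 1) {i : G.I} {σ : G.Profile}
    {g : G.Step → ℝ} {s : G.S} {z : G.Prof s → G.S → ℝ}
    (hz : ∀ a s', z a s' < brV lam i (shiftP σ ⟨s, a⟩) g s')
    {m : (j : G.I) → Mixed (G.A j s)} (hm : ∀ j, j ≠ i → m j = σ j ([], s)) :
    ∑ a, pProb m a * ((1 - lam) * g ⟨s, a⟩ + lam * ∑ s', G.q s a s' * z a s') ≤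
      brV lam i σ g s := by
  classical
  have : Nonempty (G.BStrat i) := ⟨σ i⟩
  have hex : ∀ (a : G.Prof s) (s' : G.S), ∃ ρ : G.BStrat i,
      z a s' < payG lam s' (Function.update (shiftP σ ⟨s, a⟩) i ρ) g :=
    fun a s' => exists_lt_of_lt_ciSup (hz a s')
  choose ρ hρ using hex
  let first : G.Stat i := Function.update (fun t => σ i ([], t)) s (m i)
  let ρ' : G.Step → G.S → G.BStrat i := fun st s' =>
    if h : st.1 = s then ρ (h ▸ st.2) s' else σ i
  let R := replyS first ρ'
  refine le_trans ?_ (le_ciSup (brV_bdd h0 h1 i σ g s) R)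
  rw [payG_first h0 h1]
  have hm' : (fun j => Function.update σ i R j ([], s)) = m := by
    funext j
    by_cases hj : j = i
    · subst hj
      simp [R, replyS, first]
    · rw [Function.update_of_ne hj, hm j hj]
  rw [hm']
  refine Finset.sum_le_sum fun a _ => mul_le_mul_of_nonneg_left ?_ (pProb_nonneg _ _)
  refine add_le_add le_rfl (mul_le_mul_of_nonneg_left (Finset.sum_le_sum fun s' _ =>
    mul_le_mul_of_nonneg_left ?_ (G.q_nonneg _ _ _)) h0)
  refine (hρ a s').le.trans (le_of_eq ?_)
  refine payG_profile_congr h0 h1 g fun h hh j => ?_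
  by_cases hj : j = i
  · subst hj
    simp only [shiftP, R, Function.update_self]
    rw [replyS_append, hh]
    simp [ρ']
  · simp [shiftP, Function.update_of_ne hj]

/-- The function `φ` is, up to `η`, an upper bound for what player `i` can get in the one-shot
game with continuation payoff `φ` against the stationary strategies `ξ`. -/
def SubBell (lam : ℝ) (i : G.I) (ξ : G.StatProf) (g : G.Step → ℝ) (φ : G.S → ℝ) (η : ℝ) : Prop :=
  ∀ (s : G.S) (m : (j : G.I) → Mixed (G.A j s)), (∀ j, j ≠ i → m j = ξ j s) →
    ∑ a, pProb m a * ((1 - lam) * g ⟨s, a⟩ + lam * ∑ s', G.q s a s' * φ s') ≤ φ s + η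

lemma sum_sub_const {s : G.S} (m : (j : G.I) → Mixed (G.A j s)) (f : G.Prof s → ℝ)
    (lam η : ℝ) (φ : G.S → ℝ) :
    ∑ a, pProb m a * (f a + lam * ∑ s', G.q s a s' * (φ s' - η)) =
      ∑ a, pProb m a * (f a + lam * ∑ s', G.q s a s' * φ s') - lam * η := by
  have : ∀ a, pProb m a * (f a + lam * ∑ s', G.q s a s' * (φ s' - η)) =
      pProb m a * (f a + lam * ∑ s', G.q s a s' * φ s') - pProb m a * (lam * η) := by
    intro a
    simp_rw [mul_sub]
    rw [Finset.sum_sub_distrib, ← Finset.sum_mul, G.q_sum]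
    ring
  rw [Finset.sum_congr rfl fun a _ => this a, Finset.sum_sub_distrib, ← Finset.sum_mul, sum_pProb,
    one_mul]

lemma subBell_brV {lam : ℝ} (h0 : 0 ≤ lam) (h1 : lam < 1) (i : G.I) (x : G.StatProf)
    (g : G.Step → ℝ) {η : ℝ} (hη : 0 < η) : SubBell lam i x g (brV lam i (toB x) g) η := by
  intro s m hm
  have := one_step h0 h1 (i := i) (σ := toB x) (g := g) (s := s)
    (z := fun _ s' => brV lam i (toB x) g s' - η) (fun a s' => sub_lt_self _ hη) hm
  rw [sum_sub_const] at this
  nlinarith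

lemma subBell_minmaxOrig {lam : ℝ} (h0 : 0 ≤ lam) (h1 : lam < 1) (i : G.I) (x : G.StatProf)
    {η : ℝ} (hη : 0 < η) : ∃ ξ : G.StatProf,
      SubBell lam i ξ (fun st => G.u i st.1 st.2) (fun s => minmaxOrig G lam s i) η := by
  have hne : Nonempty G.Profile := ⟨toB x⟩
  have hu : ∀ st : G.Step, |(fun st : G.Step => G.u i st.1 st.2) st| ≤ 1 :=
    fun st => G.u_bdd _ _ _
  have heq : ∀ s, minmaxOrig G lam s i =
      ⨅ σ : G.Profile, brV lam i σ (fun st => G.u i st.1 st.2) s := fun s => rfl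
  have hbdd : ∀ s, BddBelow (Set.range fun σ : G.Profile =>
      brV lam i σ (fun st => G.u i st.1 st.2) s) := fun s =>
    ⟨-1, by rintro _ ⟨σ, rfl⟩; exact (abs_le.1 (abs_brV_le h0 h1 i σ hu s)).1⟩
  have hex : ∀ s, ∃ σ : G.Profile, brV lam i σ (fun st => G.u i st.1 st.2) s <
      minmaxOrig G lam s i + η / 2 := fun s => exists_lt_of_ciInf_lt (by
    rw [← heq]; linarith)
  choose σ hσ using hex
  refine ⟨fun j s => σ s j ([], s), fun s m hm => ?_⟩
  have := one_step h0 h1 (i := i) (σ := σ s) (g := fun st => G.u i st.1 st.2) (s := s)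
    (z := fun _ s' => minmaxOrig G lam s' i - η / 2)
    (fun a s' => lt_of_lt_of_le (sub_lt_self _ (half_pos hη))
      ((heq s').le.trans (ciInf_le (hbdd s') _))) hm
  rw [sum_sub_const] at this
  have := hσ s
  nlinarith

lemma length_histOf (p : G.Play) (n : ℕ) : (histOf p n).1.length = n := by
  induction n with
  | zero => rfl
  | succ n ih => simp [histOf, ih]

lemma histOf_snd (p : G.Play) (n : ℕ) : (histOf p n).2 = (p n).1 := by cases n <;> rfl

/-- The state at stage `T` of the history with steps `l` and current state `s`. -/
def stAtAux (T : ℕ) : List G.Step → G.S → G.S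
  | [], s => s
  | ⟨s', _⟩ :: rest, s => if rest.length + 1 ≤ T then s else stAtAux T rest s'

/-- The state at stage `T` of a history (the current state if the history is shorter). -/
def stAt (T : ℕ) (h : G.Hist) : G.S := stAtAux T h.1 h.2

lemma stAt_of_le {T : ℕ} {h : G.Hist} (hT : h.1.length ≤ T) : stAt T h = h.2 := by
  obtain ⟨l, s⟩ := h
  cases l with
  | nil => rfl
  | cons st l => simp only [List.length_cons] at hT; simp [stAt, stAtAux, hT]

lemma stAt_cons {T : ℕ} {h : G.Hist} (hT : T ≤ h.1.length) (a : G.Prof h.2) (s' : G.S) :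
    stAt T (⟨h.2, a⟩ :: h.1, s') = stAt T h := by
  simp [stAt, stAtAux, Nat.lt_iff_add_one_le.symm, hT]

lemma stAt_histOf (p : G.Play) {T n : ℕ} (hT : T ≤ n) : stAt T (histOf p n) = (p T).1 := by
  induction n with
  | zero => obtain rfl : T = 0 := by omega
            rfl
  | succ n ih =>
    rcases Nat.lt_or_ge n T with h | h
    · obtain rfl : T = n + 1 := by omega
      rw [stAt_of_le (by rw [length_histOf]), histOf_snd]
    · rw [← ih h]
      have hl : ¬ ((histOf p n).1.length + 1 ≤ T) := by rw [length_histOf]; omega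
      have h2 := histOf_snd p n
      rw [stAt, stAt, h2, histOf]
      simp only [stAtAux, if_neg hl]

lemma histOf_congr {p p' : G.Play} {n : ℕ} (H : ∀ k ≤ n, p k = p' k) :
    histOf p n = histOf p' n := by
  induction n with
  | zero => simp [histOf, H]
  | succ n ih => simp [histOf, ih fun k hk => H k (by omega), H]

lemma measurable_of_prefix {α : Type*} [MeasurableSpace α] (n : ℕ) (f : G.Play → α)
    (H : ∀ p p' : G.Play, (∀ k ≤ n, p k = p' k) → f p = f p') : Measurable f := by
  let res : G.Play → (Fin (n + 1) → G.Step) := fun p k => p k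
  let ext : (Fin (n + 1) → G.Step) → G.Play := fun v k => v (Fin.ofNat (n + 1) k)
  have hf : f = (f ∘ ext) ∘ res := by
    funext p
    refine H _ _ fun k hk => ?_
    simp only [ext, res, Fin.val_ofNat]
    rw [Nat.mod_eq_of_lt (by omega)]
  rw [hf]
  have h1 : Measurable (f ∘ ext) := measurable_of_finite _
  exact h1.comp (measurable_pi_lambda _ fun k => measurable_pi_apply _)

lemma measurableSet_of_prefix (n : ℕ) (A : Set G.Play)
    (H : ∀ p p' : G.Play, (∀ k ≤ n, p k = p' k) → (p ∈ A ↔ p' ∈ A)) : MeasurableSet A := by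
  have := measurable_of_prefix n (fun p => p ∈ A) fun p p' h => propext (H p p' h)
  exact measurableSet_setOfPred.2 this

lemma integrable_of_prefix (μ : Measure G.Play) [IsFiniteMeasure μ] (n : ℕ) (f : G.Play → ℝ)
    (H : ∀ p p' : G.Play, (∀ k ≤ n, p k = p' k) → f p = f p') : Integrable f μ := by
  let res : G.Play → (Fin (n + 1) → G.Step) := fun p k => p k
  let ext : (Fin (n + 1) → G.Step) → G.Play := fun v k => v (Fin.ofNat (n + 1) k)
  have hf : ∀ p, f p = f (ext (res p)) := by
    intro p
    refine H _ _ fun k hk => ?_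
    simp only [ext, res, Fin.val_ofNat]
    rw [Nat.mod_eq_of_lt (by omega)]
  refine Integrable.of_bound (measurable_of_prefix n f H).aestronglyMeasurable
    (∑ v, |f (ext v)|) (Eventually.of_forall fun p => ?_)
  rw [Real.norm_eq_abs, hf p]
  exact Finset.single_le_sum (f := fun v => |f (ext v)|) (fun _ _ => abs_nonneg _)
    (Finset.mem_univ (res p))

variable {μfam : G.S → G.Profile → Measure G.Play}

lemma integral_hist (hind : IsInduced μfam) (s : G.S) (σ : G.Profile) (n : ℕ) (F : G.Hist → ℝ) :
    ∫ p, F (histOf p n) ∂(μfam s σ) = expN σ s n F := by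
  have := hind.1 s σ
  rw [← sum_hist_probHist]
  have hmeas : ∀ h : G.Hist, MeasurableSet (cylSet h) := fun h =>
    measurableSet_of_prefix h.1.length _ fun p p' hp => by
      simp only [cylSet, Set.mem_ofPred_eq, histOf_congr hp]
  have key : ∀ p : G.Play, F (histOf p n) = ∑ v : Fin n → G.Step, ∑ s' : G.S,
      (cylSet (List.ofFn v, s')).indicator (fun _ => F (List.ofFn v, s')) p := by
    intro p
    obtain ⟨v, hv⟩ : ∃ v : Fin n → G.Step, (histOf p n).1 = List.ofFn v := by
      have hl := length_histOf p n
      generalize (histOf p n).1 = l at hl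
      subst hl
      exact ⟨l.get, (List.ofFn_get l).symm⟩
    have hmem : ∀ (v' : Fin n → G.Step) (s' : G.S), p ∈ cylSet (List.ofFn v', s') ↔
        v' = v ∧ s' = (histOf p n).2 := by
      intro v' s'
      simp only [cylSet, Set.mem_ofPred_eq, List.length_ofFn]
      rw [Prod.ext_iff, hv]
      simp only [List.ofFn_inj]
      tauto
    rw [Finset.sum_eq_single v, Finset.sum_eq_single (histOf p n).2]
    · rw [Set.indicator_of_mem ((hmem _ _).2 ⟨rfl, rfl⟩), ← hv]
    · intro s' _ hs'
      exact Set.indicator_of_notMem (fun h => hs' ((hmem _ _).1 h).2) _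
    · simp
    · intro v' _ hv'
      exact Finset.sum_eq_zero fun s' _ =>
        Set.indicator_of_notMem (fun h => hv' ((hmem _ _).1 h).1) _
    · simp
  simp_rw [key]
  have hint : ∀ h : G.Hist, Integrable ((cylSet h).indicator fun _ => F h) (μfam s σ) :=
    fun h => (integrable_const _).indicator (hmeas h)
  rw [integral_finsetSum _ fun v _ => integrable_finsetSum _ fun s' _ => hint _]
  refine Finset.sum_congr rfl fun v _ => ?_
  rw [integral_finsetSum _ fun s' _ => hint _]
  refine Finset.sum_congr rfl fun s' _ => ?_
  rw [integral_indicator_const _ (hmeas _), Measure.real, hind.2,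
    ENNReal.toReal_ofReal (probHist_nonneg _ _ _), smul_eq_mul]

/-- The indicator function of a set of states. -/
def ind (Y : Set G.S) (s : G.S) : ℝ := Y.indicator 1 s

lemma ind_nonneg (Y : Set G.S) (s : G.S) : 0 ≤ ind Y s :=
  Set.indicator_nonneg (fun _ _ => zero_le_one) s

lemma ind_le_one (Y : Set G.S) (s : G.S) : ind Y s ≤ 1 :=
  Set.indicator_le_self' (f := (1 : G.S → ℝ)) (fun _ _ => zero_le_one) s

lemma integral_ind_mul (hind : IsInduced μfam) (s : G.S) (σ : G.Profile) {T n : ℕ} (hT : T ≤ n)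
    (Y : Set G.S) (g : G.Step → ℝ) :
    ∫ p, ind Y (p T).1 * g (p n) ∂(μfam s σ) =
      expN σ s n fun h => ind Y (stAt T h) * avgG σ g h := by
  let F : G.Hist → ℝ := fun h =>
    match h.1 with
    | [] => 0
    | st :: _ => ind Y (stAt T h) * g st
  have h1 : ∀ p : G.Play, ind Y (p T).1 * g (p n) = F (histOf p (n + 1)) := by
    intro p
    rw [← stAt_histOf p (show T ≤ n + 1 by omega)]
    rfl
  simp_rw [h1]
  rw [integral_hist hind, expN]
  refine expN_congr _ _ fun h hh => ?_
  simp only [stepE, avgG, F]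
  rw [Finset.mul_sum]
  refine Finset.sum_congr rfl fun a _ => ?_
  simp_rw [stAt_cons (h := h) (hT.trans hh.ge)]
  rw [← Finset.sum_mul, G.q_sum]
  ring

lemma payoff_of_subgamePerfect (hind : IsInduced μfam) {v : G.S → ℝ} {r : G.S → G.S → Prop}
    {i : G.I} {σ : G.Profile} {s : G.S} {ε : ℝ} (H : SubgamePerfect μfam v r i σ s ε) :
    ∃ N0 : ℕ, ∀ τ : G.Play → ℕ, IsBddST τ → (N0 : ℝ) ≤ ∫ p, (τ p : ℝ) ∂(μfam s σ) →
      (v s - ε) * ∫ p, (τ p : ℝ) ∂(μfam s σ) ≤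
        ∫ p, (∑ n ∈ Finset.range (τ p), G.u i (p n).1 (p n).2) ∂(μfam s σ) := by
  obtain ⟨N0, -, -, H⟩ := H
  refine ⟨N0, fun τ hτ hN => ?_⟩
  have hprob := hind.1 s σ
  have hm : μfam s σ (cylSet ([], s)) = 1 := by
    rw [hind.2]; simp [probHist, probHistAux]
  have hmeas : MeasurableSet (cylSet (([], s) : G.Hist)) :=
    measurableSet_of_prefix 0 _ fun p p' hp => by
      simp only [cylSet, Set.mem_ofPred_eq, List.length_nil, histOf_congr hp]
  have hr : (μfam s σ).restrict (cylSet ([], s)) = μfam s σ := by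
    refine Measure.restrict_eq_self_of_ae_mem ?_
    rw [← mem_ae_iff_prob_eq_one hmeas] at hm
    exact hm
  have := (H 0 τ hτ (fun p => zero_le) ([], s) (fun p _ => rfl)).2
  simp only [hr, hm, List.length_nil, Nat.cast_zero, sub_zero, ENNReal.toReal_one, mul_one] at this
  simp_rw [Finset.range_eq_Ico]
  exact this hN

lemma block_payoff (hind : IsInduced μfam) {v : G.S → ℝ} {r : G.S → G.S → Prop}
    {i : G.I} {σ : G.Profile} {s : G.S} {ε : ℝ} (H : SubgamePerfect μfam v r i σ s ε) :
    ∃ N0 : ℕ, ∀ (T N : ℕ) (Y : Set G.S), N0 ≤ T →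
      (v s - ε) * (T + N * expN σ s T fun h => ind Y h.2) ≤
        T + ∑ n ∈ Finset.Ico T (T + N), expN σ s n fun h =>
          ind Y (stAt T h) * avgG σ (fun st => G.u i st.1 st.2) h := by
  classical
  obtain ⟨N0, H⟩ := payoff_of_subgamePerfect hind H
  refine ⟨N0, fun T N Y hT => ?_⟩
  have hprob := hind.1 s σ
  let τ : G.Play → ℕ := fun p => T + if (p T).1 ∈ Y then N else 0
  have hτ : IsBddST τ := by
    refine ⟨⟨T + N, fun p => by simp only [τ]; split_ifs <;> omega⟩, fun p p' n h1 h2 => ?_⟩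
    have hTn : T ≤ n := by rw [← h1]; simp [τ]
    have h3 : (p T).1 = (p' T).1 := by rw [← stAt_histOf p hTn, h2, stAt_histOf p' hTn]
    rw [← h1]; simp [τ, h3]
  have hτ' : ∀ p, (τ p : ℝ) = T + N * ind Y (p T).1 := by
    intro p
    simp only [τ, ind, Set.indicator]
    split_ifs <;> simp
  have hindint : Integrable (fun p : G.Play => ind Y (p T).1) (μfam s σ) :=
    integrable_of_prefix _ T _ fun p p' h => by rw [h T le_rfl]
  have hexp : ∫ p, ind Y (p T).1 ∂(μfam s σ) = expN σ s T fun h => ind Y h.2 := by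
    rw [← integral_hist hind]
    simp_rw [histOf_snd]
  have hEτ : ∫ p, (τ p : ℝ) ∂(μfam s σ) = T + N * expN σ s T fun h => ind Y h.2 := by
    simp_rw [hτ']
    rw [integral_add (integrable_const _) (hindint.const_mul _), integral_const_mul, hexp]
    simp
  have hge : (N0 : ℝ) ≤ ∫ p, (τ p : ℝ) ∂(μfam s σ) := by
    rw [hEτ]
    have h1 : (N0 : ℝ) ≤ T := by exact_mod_cast hT
    have h2 : 0 ≤ expN σ s T fun h => ind Y h.2 := expN_nonneg _ _ fun _ _ => ind_nonneg _ _
    have := mul_nonneg (Nat.cast_nonneg (α := ℝ) N) h2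
    linarith
  have key := H τ hτ hge
  rw [hEτ] at key
  refine key.trans ?_
  have hterm : ∀ n, Integrable (fun p : G.Play => ind Y (p T).1 * G.u i (p n).1 (p n).2)
      (μfam s σ) := fun n => integrable_of_prefix _ (max T n) _ fun p p' h => by
    rw [h T (le_max_left _ _), h n (le_max_right _ _)]
  have hR : (T : ℝ) + ∑ n ∈ Finset.Ico T (T + N), expN σ s n (fun h =>
      ind Y (stAt T h) * avgG σ (fun st => G.u i st.1 st.2) h) =
      ∫ p, ((T : ℝ) + ∑ n ∈ Finset.Ico T (T + N), ind Y (p T).1 * G.u i (p n).1 (p n).2)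
        ∂(μfam s σ) := by
    rw [integral_add (integrable_const _) (integrable_finsetSum _ fun n _ => hterm n),
      integral_finsetSum _ fun n _ => hterm n]
    simp only [integral_const, probReal_univ, one_smul]
    congr 1
    refine Finset.sum_congr rfl fun n hn => ?_
    exact (integral_ind_mul hind s σ (Finset.mem_Ico.1 hn).1 Y
      fun st => G.u i st.1 st.2).symm
  rw [hR]
  have hpt : ∀ p : G.Play, ∑ n ∈ Finset.range (τ p), G.u i (p n).1 (p n).2 ≤
      (T : ℝ) + ∑ n ∈ Finset.Ico T (T + N), ind Y (p T).1 * G.u i (p n).1 (p n).2 := by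
    intro p
    have h1 : ∑ n ∈ Finset.range T, G.u i (p n).1 (p n).2 ≤ T := by
      calc _ ≤ ∑ n ∈ Finset.range T, (1 : ℝ) :=
            Finset.sum_le_sum fun n _ => (abs_le.1 (G.u_bdd _ _ _)).2
        _ = T := by simp
    by_cases hp : (p T).1 ∈ Y
    · simp only [τ, hp, if_true, ind, Set.indicator_of_mem, Pi.one_apply, one_mul]
      rw [← Finset.sum_range_add_sum_Ico _ (Nat.le_add_right T N)]
      linarith
    · simpa [τ, hp, ind] using h1
  have hsplit : ∀ p : G.Play, ∑ n ∈ Finset.range (τ p), G.u i (p n).1 (p n).2 =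
      ∑ n ∈ Finset.range T, G.u i (p n).1 (p n).2 +
        ∑ n ∈ Finset.Ico T (T + N), ind Y (p T).1 * G.u i (p n).1 (p n).2 := by
    intro p
    by_cases hp : (p T).1 ∈ Y
    · simp only [τ, hp, if_true, ind, Set.indicator_of_mem, Pi.one_apply, one_mul]
      rw [Finset.sum_range_add_sum_Ico _ (Nat.le_add_right T N)]
    · simp [τ, hp, ind]
  refine integral_mono ?_ ((integrable_const _).add (integrable_finsetSum _ fun n _ => hterm n))
    hpt
  simp_rw [hsplit]
  exact (integrable_finsetSum _ fun n _ => integrable_of_prefix _ n _ fun p p' h => by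
    rw [h n le_rfl]).add (integrable_finsetSum _ fun n _ => hterm n)

open Classical in
lemma few_switches (hind : IsInduced μfam) {Di : Finset (Finset G.S)} (hDi : IsPartitionF Di)
    {σ : G.Profile} {s : G.S} {ε ζ : ℝ} (hε : 0 < ε) (hε1 : ε ≤ 1) {E : Set G.Play}
    (hE : ENNReal.ofReal (1 - ε) ≤ μfam s σ E)
    (hZ : ∫⁻ p in E, Zsw (sameOf Di) p ∂(μfam s σ) ≤ ENNReal.ofReal ζ) :
    ∃ T1 : ℕ, ∀ T n : ℕ, T1 ≤ T → T ≤ n →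
      expN σ s n (fun h => if sameOf Di (stAt T h) h.2 then 0 else 1) ≤ 2 * ε := by
  have hprob := hind.1 s σ
  set μ := μfam s σ
  let b : ℕ → G.Play → ℝ≥0∞ := fun n p => if sameOf Di (p n).1 (p (n + 1)).1 then 0 else 1
  have hb : ∀ n, Measurable (b n) := fun n => measurable_of_prefix (n + 1) _ fun p p' h => by
    simp only [b, h n (by omega), h (n + 1) le_rfl]
  set E' := toMeasurable μ E with hE'
  have hE'm : MeasurableSet E' := measurableSet_toMeasurable _ _
  have hfin : ∑' n, ∫⁻ p in E', b n p ∂μ ≠ ⊤ := by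
    rw [← lintegral_tsum fun n => (hb n).aemeasurable,
      Measure.restrict_toMeasurable (measure_ne_top _ _)]
    exact ne_top_of_le_ne_top ENNReal.ofReal_ne_top hZ
  have htail := ENNReal.tendsto_sum_nat_add _ hfin
  have hev := htail.eventually (gt_mem_nhds (ENNReal.ofReal_pos.2 hε))
  obtain ⟨T1, hT1⟩ := eventually_atTop.1 hev
  refine ⟨T1, fun T n hT hTn => ?_⟩
  set A : Set G.Play := {p | ¬ sameOf Di (p T).1 (p n).1} with hA
  have hAm : MeasurableSet A := measurableSet_of_prefix n _ fun p p' h => by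
    simp only [hA, Set.mem_ofPred_eq, h T hTn, h n le_rfl]
  have hexp : expN σ s n (fun h => if sameOf Di (stAt T h) h.2 then 0 else 1) = μ.real A := by
    rw [← integral_hist hind, ← integral_indicator_one hAm]
    congr 1
    funext p
    rw [stAt_histOf p hTn, histOf_snd]
    simp only [hA, Set.indicator, Set.mem_ofPred_eq, Pi.one_apply]
    split_ifs <;> simp_all
  have hpt : ∀ p ∈ A, (1 : ℝ≥0∞) ≤ ∑' k, b (k + T) p := by
    intro p hp
    by_contra hcon
    have hall : ∀ k, sameOf Di (p (k + T)).1 (p (k + T + 1)).1 := by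
      intro k
      by_contra hk
      refine hcon (le_trans ?_ (ENNReal.le_tsum k))
      simp [b, hk]
    have : ∀ k, sameOf Di (p T).1 (p (T + k)).1 := by
      intro k
      induction k with
      | zero => exact ⟨_, (partOf_mem hDi _).1, (partOf_mem hDi _).2, (partOf_mem hDi _).2⟩
      | succ k ih =>
        obtain ⟨D, hD, h1, h2⟩ := ih
        obtain ⟨D', hD', h3, h4⟩ := hall k
        rw [add_comm k T] at h3 h4
        obtain rfl : D = D' := by rw [eq_partOf hDi hD h2, eq_partOf hDi hD' h3]
        exact ⟨D, hD, h1, h4⟩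
    have h5 := this (n - T)
    rw [Nat.add_sub_cancel' hTn] at h5
    exact hp h5
  have hAE : μ (A ∩ E') ≤ ENNReal.ofReal ε := by
    rw [← Measure.restrict_apply hAm, ← lintegral_indicator_one hAm]
    calc ∫⁻ p in E', A.indicator 1 p ∂μ ≤ ∫⁻ p in E', ∑' k, b (k + T) p ∂μ := by
          refine lintegral_mono fun p => ?_
          by_cases hp : p ∈ A
          · simpa [hp] using hpt p hp
          · simp [hp]
      _ = ∑' k, ∫⁻ p in E', b (k + T) p ∂μ := lintegral_tsum fun k => (hb _).aemeasurable
      _ ≤ _ := (hT1 T hT).le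
  have hEc : μ E'ᶜ ≤ ENNReal.ofReal ε := by
    rw [prob_compl_eq_one_sub hE'm, measure_toMeasurable]
    calc 1 - μ E ≤ 1 - ENNReal.ofReal (1 - ε) := tsub_le_tsub_left hE 1
      _ = ENNReal.ofReal ε := by
        rw [← ENNReal.ofReal_one, ← ENNReal.ofReal_sub _ (by linarith)]
        congr 1; ring
  have hAtot : μ A ≤ ENNReal.ofReal (2 * ε) := by
    calc μ A ≤ μ (A ∩ E' ∪ E'ᶜ) := measure_mono fun p hp => by
          by_cases h : p ∈ E'
          · exact Or.inl ⟨hp, h⟩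
          · exact Or.inr h
      _ ≤ μ (A ∩ E') + μ E'ᶜ := measure_union_le _ _
      _ ≤ ENNReal.ofReal ε + ENNReal.ofReal ε := add_le_add hAE hEc
      _ = _ := by rw [← ENNReal.ofReal_add hε.le hε.le, two_mul]
  rw [hexp]
  exact ENNReal.toReal_le_of_le_ofReal (by linarith) hAtot

end StocGame

/-- A sequence that satisfies a discounted Bellman-type inequality over a short block does not
increase much. -/
lemma short_block_le {a b : ℕ → ℝ} {L : ℕ} {lam P C η : ℝ} (h1 : lam < 1)
    (hstep : ∀ n < L, lam * a (n + 1) + (1 - lam) * b n ≤ a n + (1 - lam) * (η * P))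
    (ha : ∀ n, |a n| ≤ C * P) (hb : ∀ n, |b n| ≤ C * P) {j : ℕ} (hj : j ≤ L) :
    a j ≤ a 0 + (1 - lam) * j * ((2 * C + η) * P) := by
  induction j with
  | zero => simp
  | succ j ih =>
    have h2 := ih (by omega)
    have h3 := hstep j (by omega)
    have h4 := (abs_le.1 (ha (j + 1))).2
    have h5 := (abs_le.1 (hb j)).1
    push_cast
    nlinarith

/-- Over a short block, the sum of stage payoffs is bounded by the potential. -/
lemma short_block_sum_le {a b : ℕ → ℝ} {L : ℕ} {lam P C η κ : ℝ} (h1 : lam < 1)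
    (hstep : ∀ n < L, lam * a (n + 1) + (1 - lam) * b n ≤ a n + (1 - lam) * (η * P))
    (ha : ∀ n, |a n| ≤ C * P) (hb : ∀ n, |b n| ≤ C * P) (hP : 0 ≤ (2 * C + η) * P)
    (hκ : (1 - lam) * L ≤ κ) {j : ℕ} (hj : j ≤ L) :
    a j + (1 - lam) * ∑ n ∈ Finset.range j, b n ≤
      a 0 + (1 - lam) * j * (a 0 + κ * ((2 * C + η) * P) + η * P) := by
  induction j with
  | zero => simp
  | succ j ih =>
    have h2 := ih (by omega)
    have h3 := hstep j (by omega)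
    have h4 := short_block_le h1 hstep ha hb hj
    have h5 : (1 - lam) * ((j + 1 : ℕ) : ℝ) ≤ κ := by
      refine le_trans ?_ hκ
      have : ((j + 1 : ℕ) : ℝ) ≤ L := by exact_mod_cast hj
      exact mul_le_mul_of_nonneg_left this (by linarith)
    have h6 : a (j + 1) ≤ a 0 + κ * ((2 * C + η) * P) :=
      h4.trans (by linarith [mul_le_mul_of_nonneg_right h5 hP])
    have h7 := mul_le_mul_of_nonneg_left h6 (sub_pos.2 h1).le
    rw [Finset.sum_range_succ]
    push_cast
    linarith

namespace StocGame

variable {G : StocGame}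

lemma stepE_ind_mul (σ : G.Profile) (Y : Set G.S) {T : ℕ} {h : G.Hist} (hT : T ≤ h.1.length)
    (F : G.Hist → ℝ) :
    stepE σ (fun h' => ind Y (stAt T h') * F h') h = ind Y (stAt T h) * stepE σ F h := by
  rw [← stepE_const_mul]
  exact stepE_congr σ fun a s' => by rw [stAt_cons hT]

lemma expN_ind_stAt (σ : G.Profile) (s : G.S) (Y : Set G.S) {T n : ℕ} (hT : T ≤ n) :
    expN σ s n (fun h => ind Y (stAt T h)) = expN σ s T fun h => ind Y h.2 := by
  induction n, hT using Nat.le_induction with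
  | base => exact expN_congr _ _ fun h hh => by rw [stAt_of_le hh.le]
  | succ n hn ih =>
    rw [expN, ← ih]
    refine expN_congr _ _ fun h hh => ?_
    have := stepE_ind_mul σ Y (hn.trans hh.ge) fun _ => 1
    simp only [mul_one, stepE_const] at this
    exact this

lemma abs_expN_ind_mul_le (σ : G.Profile) (s : G.S) (Y : Set G.S) {T n : ℕ} (hT : T ≤ n)
    {F : G.Hist → ℝ} {C : ℝ} (hF : ∀ h, |F h| ≤ C) :
    |expN σ s n fun h => ind Y (stAt T h) * F h| ≤ C * expN σ s T fun h => ind Y h.2 := by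
  rw [← expN_ind_stAt σ s Y hT, abs_le, ← expN_const_mul, ← neg_one_mul, ← expN_const_mul]
  constructor <;> refine expN_mono _ _ fun h _ => ?_
  · nlinarith [ind_nonneg Y (stAt T h), (abs_le.1 (hF h)).1]
  · nlinarith [ind_nonneg Y (stAt T h), (abs_le.1 (hF h)).2]

lemma expN_ind_zero_of_mul (σ : G.Profile) (s : G.S) {n : ℕ} {Y : Set G.S}
    (hY : expN σ s n (fun h => ind Y h.2) = 0) {F F' : G.Hist → ℝ} {B : ℝ}
    (H : ∀ h, F h ≤ F' h + B * ind Y h.2) : expN σ s n F ≤ expN σ s n F' := by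
  have := expN_mono σ s (n := n) fun h _ => H h
  rwa [expN_add, expN_const_mul, hY, mul_zero, add_zero] at this

/-- If player `i`'s opponents play, along blocks, strategies that keep the potential `φ k` from
increasing, and the play is at stage `T k` in the lowest level `Y` of the limit potential with
probability bounded away from `0`, then the payoffs on the blocks cannot exceed the level. -/
theorem level_lemma {σ : G.Profile} {s : G.S} {T L : ℕ → ℕ} (hT : ∀ k, T (k + 1) = T k + L k)
    {lam κ : ℕ → ℝ} {g : ℕ → G.Step → ℝ} {φ : ℕ → G.S → ℝ} {φl : G.S → ℝ} {Y R : Set G.S}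
    {y ρ δ C K p : ℝ} (hC : 1 ≤ C) (hρ : 0 < ρ) (hδ : 0 < δ) (hδ1 : δ ≤ 1) (hK : 0 ≤ K)
    (hκ0 : ∀ k, 0 < κ k) (hκρ : ∀ k, (2 * C + 3) * κ k ≤ ρ * (1 / 2) ^ (k + 2))
    (hκδ : ∀ k, (2 * C + 2) * κ k ≤ δ / 8)
    (h1 : ∀ k, lam k < 1) (hL : ∀ k, (1 - lam k) * L k ≤ κ k)
    (hL' : ∀ k, κ k / 2 ≤ (1 - lam k) * L k) (hlT : ∀ k, (1 - lam k) * T k ≤ κ k / (k + 1))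
    (hφl : ∀ k s, |φ k s - φl s| ≤ κ k / (k + 1)) (hφ : ∀ k s, |φ k s| ≤ C)
    (hg : ∀ k st, |g k st| ≤ C) (hY : ∀ s ∈ Y, φl s = y) (hR : ∀ s ∈ R, s ∉ Y → y + ρ ≤ φl s)
    (hRas : ∀ k, expN σ s (T k) (fun h => ind Rᶜ h.2) = 0)
    (HB : ∀ k (h : G.Hist), T k ≤ h.1.length → h.1.length < T k + L k → stAt (T k) h ∈ Y →
      (1 - lam k) * avgG σ (g k) h + lam k * stepE σ (fun h' => φ k h'.2) h ≤
        φ k h.2 + (1 - lam k) * (δ / 8))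
    (hp : 0 < p) {j : ℕ} (hj : p ≤ expN σ s (T j) fun h => ind Y h.2)
    (Hpay : ∃ K2, ∀ k ≥ K2, p / 2 ≤ expN σ s (T k) (fun h => ind Y h.2) →
      (y + δ / 2) * L k * expN σ s (T k) (fun h => ind Y h.2) - K * T k ≤
        ∑ n ∈ Finset.range (L k), expN σ s (T k + n) fun h =>
          ind Y (stAt (T k) h) * avgG σ (g k) h) : False := by
  set P : ℕ → ℝ := fun k => expN σ s (T k) fun h => ind Y h.2 with hPdef
  have hP0 : ∀ k, 0 ≤ P k := fun k => expN_nonneg _ _ fun h _ => ind_nonneg _ _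
  have hP1 : ∀ k, P k ≤ 1 := fun k => by
    have := expN_mono σ s (n := T k) (F := fun h => ind Y h.2) (F' := fun _ => 1)
      fun h _ => ind_le_one _ _
    rwa [expN_const] at this
  let a : ℕ → ℕ → ℝ := fun k n => expN σ s (T k + n) fun h => ind Y (stAt (T k) h) * φ k h.2
  let b : ℕ → ℕ → ℝ := fun k n => expN σ s (T k + n) fun h =>
    ind Y (stAt (T k) h) * avgG σ (g k) h
  have ha : ∀ k n, |a k n| ≤ C * P k := fun k n =>
    abs_expN_ind_mul_le σ s Y (by omega) fun h => hφ k h.2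
  have hb : ∀ k n, |b k n| ≤ C * P k := fun k n =>
    abs_expN_ind_mul_le σ s Y (by omega) fun h => abs_avgG_le σ (hg k) h
  have hstep : ∀ k, ∀ n < L k, lam k * a k (n + 1) + (1 - lam k) * b k n ≤
      a k n + (1 - lam k) * (δ / 8 * P k) := by
    intro k n hn
    have e1 : a k (n + 1) = expN σ s (T k + n) fun h =>
        ind Y (stAt (T k) h) * stepE σ (fun h' => φ k h'.2) h := by
      simp only [a]
      rw [← add_assoc, expN]
      exact expN_congr _ _ fun h hh => stepE_ind_mul σ Y (by omega) _
    have e2 : a k n + (1 - lam k) * (δ / 8 * P k) = expN σ s (T k + n) fun h =>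
        1 * (ind Y (stAt (T k) h) * φ k h.2) +
          ((1 - lam k) * (δ / 8)) * ind Y (stAt (T k) h) := by
      rw [expN_linear, expN_ind_stAt σ s Y (by omega)]
      simp only [a, P]; ring
    rw [e1, e2]
    simp only [b]
    rw [← expN_linear]
    refine expN_mono _ _ fun h hh => ?_
    by_cases hm : stAt (T k) h ∈ Y
    · have := HB k h (by omega) (by omega) hm
      simp only [ind, Set.indicator_of_mem hm, Pi.one_apply]
      linarith
    · simp [ind, hm]
  have ha0 : ∀ k, a k 0 ≤ (y + κ k / (k + 1)) * P k := by
    intro k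
    simp only [a, P]
    rw [← expN_const_mul]
    refine expN_mono _ _ fun h hh => ?_
    rw [stAt_of_le (by rw [hh]; simp)]
    by_cases hm : h.2 ∈ Y
    · have h2 := (abs_le.1 (hφl k h.2)).2
      rw [hY _ hm] at h2
      simp only [ind, Set.indicator_of_mem hm, Pi.one_apply]
      linarith
    · simp [ind, hm]
  set Q : ℕ → ℝ := fun k => expN σ s (T (k + 1)) fun h => ind Y (stAt (T k) h) * ind Y h.2
  have hQ1 : ∀ k, Q k ≤ P (k + 1) := fun k => expN_mono _ _ fun h _ => by
    nlinarith [ind_le_one Y (stAt (T k) h), ind_nonneg Y h.2]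
  have hQ2 : ∀ k, Q k ≤ P k := fun k => by
    simp only [P]
    rw [← expN_ind_stAt σ s Y (show T k ≤ T (k + 1) by rw [hT]; omega)]
    exact expN_mono _ _ fun h _ => by
      nlinarith [ind_le_one Y h.2, ind_nonneg Y (stAt (T k) h)]
  have haL : ∀ k, (y - κ k / (k + 1)) * P k + ρ * (P k - Q k) ≤ a k (L k) := by
    intro k
    have hTk : T k ≤ T (k + 1) := by rw [hT]; omega
    have e : (y - κ k / (k + 1)) * P k + ρ * (P k - Q k) = expN σ s (T (k + 1)) fun h =>
        (y - κ k / (k + 1) + ρ) * ind Y (stAt (T k) h) +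
          (-ρ) * (ind Y (stAt (T k) h) * ind Y h.2) := by
      rw [expN_linear, expN_ind_stAt σ s Y hTk]
      simp only [P, Q]; ring
    rw [e]
    simp only [a]
    rw [← hT]
    refine expN_ind_zero_of_mul σ s (hRas (k + 1)) (B := |y - κ k / (k + 1)| + ρ + C) fun h => ?_
    have h2 := (abs_le.1 (hφl k h.2)).1
    have hκk : 0 ≤ κ k / (k + 1) := div_nonneg (hκ0 k).le (by positivity)
    by_cases hm : stAt (T k) h ∈ Y
    · rw [show ind Y (stAt (T k) h) = 1 from Set.indicator_of_mem hm _]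
      by_cases hm2 : h.2 ∈ Y
      · rw [show ind Y h.2 = 1 from Set.indicator_of_mem hm2 _]
        rw [hY _ hm2] at h2
        have := mul_nonneg (show 0 ≤ |y - κ k / (k + 1)| + ρ + C by positivity) (ind_nonneg Rᶜ h.2)
        linarith
      · rw [show ind Y h.2 = 0 from Set.indicator_of_notMem hm2 _]
        by_cases hm3 : h.2 ∈ R
        · have h3 := hR _ hm3 hm2
          rw [show ind Rᶜ h.2 = 0 from Set.indicator_of_notMem (by simpa using hm3) _]
          linarith
        · rw [show ind Rᶜ h.2 = 1 from Set.indicator_of_mem (by simpa using hm3) _]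
          have h4 := le_abs_self (y - κ k / (k + 1))
          have h5 := (abs_le.1 (hφ k h.2)).1
          linarith
    · rw [show ind Y (stAt (T k) h) = 0 from Set.indicator_of_notMem hm _]
      have := mul_nonneg (show 0 ≤ |y - κ k / (k + 1)| + ρ + C by positivity) (ind_nonneg Rᶜ h.2)
      linarith
  have hκle : ∀ k : ℕ, κ k / (k + 1) ≤ κ k := fun k =>
    div_le_self (hκ0 k).le (by linarith [Nat.cast_nonneg (α := ℝ) k])
  have hCP : ∀ k, 0 ≤ (2 * C + δ / 8) * P k := fun k => mul_nonneg (by linarith) (hP0 k)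
  have hretain : ∀ k, P k * (1 - (1 / 2) ^ (k + 2)) ≤ P (k + 1) := by
    intro k
    have e1 := short_block_le (h1 k) (hstep k) (ha k) (hb k) le_rfl
    have e2 := mul_le_mul_of_nonneg_right (hL k) (hCP k)
    have e3 := haL k
    have e4 := ha0 k
    have e5 : κ k / (k + 1) * P k ≤ κ k * P k := mul_le_mul_of_nonneg_right (hκle k) (hP0 k)
    have e6 : κ k * ((2 * C + δ / 8) * P k) ≤ κ k * ((2 * C + 1) * P k) :=
      mul_le_mul_of_nonneg_left (mul_le_mul_of_nonneg_right (by linarith) (hP0 k)) (hκ0 k).le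
    have e7 : ρ * (P k - Q k) ≤ (2 * C + 3) * κ k * P k := by linarith
    have e8 : (2 * C + 3) * κ k * P k ≤ ρ * (1 / 2) ^ (k + 2) * P k :=
      mul_le_mul_of_nonneg_right (hκρ k) (hP0 k)
    have e9 : P k - Q k ≤ (1 / 2) ^ (k + 2) * P k := by
      refine le_of_mul_le_mul_left ?_ hρ
      linarith
    linarith [hQ1 k]
  have hkeep : ∀ k ≥ j, p * (1 / 2 + (1 / 2) ^ (k + 1)) ≤ P k := by
    intro k hk
    induction k, hk using Nat.le_induction with
    | base =>
      refine le_trans ?_ hj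
      have : (1 / 2 : ℝ) ^ (j + 1) ≤ (1 / 2) ^ 1 :=
        pow_le_pow_of_le_one (by norm_num) (by norm_num) (by omega)
      nlinarith
    | succ k hk ih =>
      refine le_trans ?_ (hretain k)
      have hz : 0 < (1 / 2 : ℝ) ^ (k + 2) := by positivity
      have hz1 : (1 / 2 : ℝ) ^ (k + 2) ≤ (1 / 2) ^ 2 :=
        pow_le_pow_of_le_one (by norm_num) (by norm_num) (by omega)
      have e1 : (1 / 2 : ℝ) ^ (k + 1) = 2 * (1 / 2) ^ (k + 2) := by rw [pow_succ _ (k + 1)]; ring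
      rw [e1] at ih
      set z := (1 / 2 : ℝ) ^ (k + 2)
      have e2 : p * (1 / 2 + 2 * z) * (1 - z) ≤ P k * (1 - z) :=
        mul_le_mul_of_nonneg_right ih (by norm_num at hz1; linarith)
      refine le_trans ?_ e2
      rw [mul_assoc]
      refine mul_le_mul_of_nonneg_left ?_ hp.le
      norm_num at hz1
      nlinarith
  have hhalf : ∀ k ≥ j, p / 2 ≤ P k := fun k hk => by
    refine le_trans ?_ (hkeep k hk)
    have : 0 ≤ p * (1 / 2 : ℝ) ^ (k + 1) := by positivity
    linarith
  obtain ⟨K2, Hpay⟩ := Hpay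
  have hdrop : ∀ k ≥ max j K2, p / 2 * (δ / 8) ≤ (2 + K) / (k + 1) := by
    intro k hk
    have hkj : j ≤ k := (le_max_left _ _).trans hk
    have e1 := short_block_sum_le (h1 k) (hstep k) (ha k) (hb k) (hCP k) (hL k) le_rfl
    have e2 := mul_le_mul_of_nonneg_left (Hpay k ((le_max_right _ _).trans hk) (hhalf k hkj))
      (sub_pos.2 (h1 k)).le
    have e3 := haL k
    have e3' : 0 ≤ ρ * (P k - Q k) := mul_nonneg hρ.le (sub_nonneg.2 (hQ2 k))
    have e4 := ha0 k
    have hk1 : (0 : ℝ) < k + 1 := by positivity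
    set η := κ k / (k + 1) with hη
    have hη0 : 0 < η := div_pos (hκ0 k) hk1
    have e5 : κ k * ((2 * C + δ / 8) * P k) ≤ κ k * ((2 * C + 1) * P k) :=
      mul_le_mul_of_nonneg_left (mul_le_mul_of_nonneg_right (by linarith) (hP0 k)) (hκ0 k).le
    set M := (1 - lam k) * L k with hM
    have hM0 : 0 ≤ M := mul_nonneg (sub_pos.2 (h1 k)).le (Nat.cast_nonneg _)
    have e6 : a k 0 + κ k * ((2 * C + δ / 8) * P k) + δ / 8 * P k ≤ (y + δ / 4) * P k := by
      have : (2 * C + 2) * κ k * P k ≤ δ / 8 * P k := mul_le_mul_of_nonneg_right (hκδ k) (hP0 k)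
      have h7 : η * P k ≤ κ k * P k := mul_le_mul_of_nonneg_right (hκle k) (hP0 k)
      linarith
    have e7 := mul_le_mul_of_nonneg_left e6 hM0
    have e8 : (1 - lam k) * ((y + δ / 2) * L k * P k - K * T k) =
        M * ((y + δ / 2) * P k) - K * ((1 - lam k) * T k) := by rw [hM]; ring
    rw [e8] at e2
    have e9 : K * ((1 - lam k) * T k) ≤ K * η := mul_le_mul_of_nonneg_left (hlT k) hK
    have e10 : M * (δ / 4 * P k) ≤ 2 * (η * P k) + K * η := by
      simp only [b] at e1
      linarith
    have e11 : η * P k ≤ η := mul_le_of_le_one_right hη0.le (hP1 k)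
    have e12 : κ k / 2 * (δ / 4 * (p / 2)) ≤ M * (δ / 4 * P k) :=
      mul_le_mul (hL' k) (mul_le_mul_of_nonneg_left (hhalf k hkj) (by linarith))
        (by positivity) hM0
    have e13 : κ k * (p / 2 * (δ / 8)) ≤ κ k * ((2 + K) / (k + 1)) := by
      have : κ k * ((2 + K) / (k + 1)) = (2 + K) * η := by rw [hη]; ring
      rw [this]
      linarith
    exact le_of_mul_le_mul_left e13 (hκ0 k)
  have hpos : 0 < p / 2 * (δ / 8) := by positivity
  obtain ⟨n, hn⟩ := exists_nat_gt ((2 + K) / (p / 2 * (δ / 8)))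
  have h2 := hdrop (max n (max j K2)) (le_max_right _ _)
  have h3 : (n : ℝ) ≤ (max n (max j K2) : ℕ) := by exact_mod_cast le_max_left _ _
  rw [le_div_iff₀ (by positivity)] at h2
  rw [div_lt_iff₀ hpos] at hn
  nlinarith

end StocGame

lemma exists_gap {S : Type*} [Finite S] (f : S → ℝ) :
    ∃ ρ > 0, ∀ s t, f s < f t → f s + ρ ≤ f t := by
  classical
  have := Fintype.ofFinite S
  let A : Finset (S × S) := Finset.univ.filter fun z => f z.1 < f z.2
  rcases A.eq_empty_or_nonempty with hA | hA
  · refine ⟨1, one_pos, fun s t h => ?_⟩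
    have : (s, t) ∈ A := by simp [A, h]
    simp [hA] at this
  · obtain ⟨z, hz, hmin⟩ := A.exists_min_image (fun z => f z.2 - f z.1) hA
    refine ⟨f z.2 - f z.1, sub_pos.2 (by simpa [A] using hz), fun s t h => ?_⟩
    have := hmin (s, t) (by simp [A, h])
    simp only at this
    linarith

namespace StocGame

variable {G : StocGame}

lemma SubBell.hist {lam η : ℝ} {i : G.I} {ξ : G.StatProf} {g : G.Step → ℝ} {φ : G.S → ℝ}
    (H : SubBell lam i ξ g φ η) {σ : G.Profile} {h : G.Hist}
    (hσ : ∀ j, j ≠ i → σ j h = ξ j h.2) :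
    (1 - lam) * avgG σ g h + lam * stepE σ (fun h' => φ h'.2) h ≤ φ h.2 + η := by
  refine le_of_eq_of_le ?_ (H h.2 (fun j => σ j h) hσ)
  unfold avgG stepE
  rw [Finset.mul_sum, Finset.mul_sum, ← Finset.sum_add_distrib]
  refine Finset.sum_congr rfl fun a _ => ?_
  ring

lemma abs_minmaxOrig_le {lam : ℝ} (h0 : 0 ≤ lam) (h1 : lam < 1) (x : G.StatProf) (s : G.S)
    (i : G.I) : |minmaxOrig G lam s i| ≤ 1 := by
  have hne : Nonempty G.Profile := ⟨toB x⟩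
  have hb : ∀ σ : G.Profile, |brV lam i σ (fun st => G.u i st.1 st.2) s| ≤ 1 :=
    fun σ => abs_brV_le h0 h1 i σ (fun st => G.u_bdd _ _ _) s
  have heq : minmaxOrig G lam s i =
      ⨅ σ : G.Profile, brV lam i σ (fun st => G.u i st.1 st.2) s := rfl
  rw [heq, abs_le]
  exact ⟨le_ciInf fun σ => (abs_le.1 (hb σ)).1,
    (ciInf_le ⟨-1, by rintro _ ⟨σ, rfl⟩; exact (abs_le.1 (hb σ)).1⟩ (toB x)).trans
      (abs_le.1 (hb _)).2⟩

lemma abs_convexComb_le {α u c C : ℝ} (hα : 0 ≤ α ∧ α ≤ 1) (hu : |u| ≤ C) (hc : |c| ≤ C) :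
    |α * u + (1 - α) * c| ≤ C := by
  rw [abs_le] at *
  constructor <;> nlinarith

lemma abs_mixPay_le {Di : Finset (Finset G.S)} (hDi : IsPartitionF Di) {c : Finset G.S → ℝ}
    {C : ℝ} (hC : 1 ≤ C) (hc : ∀ D ∈ Di, |c D| ≤ C) (i : G.I) {α : Finset G.S → ℝ}
    (hα : ∀ D, 0 ≤ α D ∧ α D ≤ 1) (st : G.Step) : |mixPay Di hDi c i α st| ≤ C :=
  abs_convexComb_le (hα _) ((G.u_bdd _ _ _).trans hC) (hc _ (partOf_mem hDi _).1)

lemma exists_limit_potential {i : G.I} {Di : Finset (Finset G.S)} (hDi : IsPartitionF Di)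
    {c : Finset G.S → ℝ} {C : ℝ} (hC : 1 ≤ C) (hc : ∀ D ∈ Di, |c D| ≤ C) {s0 : G.S}
    {x : ℝ → G.StatProf}
    (hx : ∀ lam : ℝ, 0 ≤ lam → lam < 1 → ∀ σi : G.BStrat i,
      modPayoff lam s0 (Function.update (toB (x lam)) i σi) i Di c ≤
        modPayoff lam s0 (toB (x lam)) i Di c) {b : ℝ}
    (hfreq : ∃ᶠ lam in 𝓝[<] (1 : ℝ), modPayoff lam s0 (toB (x lam)) i Di c < b) :
    ∃ φl : G.S → ℝ, φl s0 ≤ b ∧ ∀ η > 0, ∃ᶠ lam in 𝓝[<] (1 : ℝ),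
      ∃ (φ : G.S → ℝ) (α : Finset G.S → ℝ) (ξ : G.StatProf), (∀ D, 0 ≤ α D ∧ α D ≤ 1) ∧
        (∀ η' > 0, SubBell lam i ξ (mixPay Di hDi c i α) φ η') ∧ (∀ s, |φ s| ≤ C) ∧
        ∀ s, |φ s - φl s| ≤ η := by
  classical
  let Good : ℝ → Prop := fun lam =>
    0 ≤ lam ∧ lam < 1 ∧ modPayoff lam s0 (toB (x lam)) i Di c < b
  let Dat : ℝ → (G.S → ℝ) → Prop := fun lam φ => ∃ (α : Finset G.S → ℝ) (ξ : G.StatProf),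
    (∀ D, 0 ≤ α D ∧ α D ≤ 1) ∧ (∀ η' > 0, SubBell lam i ξ (mixPay Di hDi c i α) φ η')
  have hD : ∀ lam, ∃ φ : G.S → ℝ, Good lam → Dat lam φ ∧ (∀ s, |φ s| ≤ C) ∧ φ s0 ≤ b := by
    intro lam
    by_cases hg : Good lam
    · obtain ⟨h0, h1, h2⟩ := hg
      obtain ⟨α, hα, H⟩ := exists_linearization h0 h1 s0 (toB (x lam)) i hDi c (hx lam h0 h1)
      have : Nonempty (G.BStrat i) := ⟨toB (x lam) i⟩
      exact ⟨brV lam i (toB (x lam)) (mixPay Di hDi c i α), fun _ =>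
        ⟨⟨α, x lam, hα, fun η' hη' => subBell_brV h0 h1 i _ _ hη'⟩,
          abs_brV_le h0 h1 i _ (abs_mixPay_le hDi hC hc i hα),
          (ciSup_le H).trans h2.le⟩⟩
    · exact ⟨0, fun h => absurd h hg⟩
  choose Φ hΦ using hD
  have hgood : ∃ᶠ lam in 𝓝[<] (1 : ℝ), Good lam := by
    have h01 : ∀ᶠ lam in 𝓝[<] (1 : ℝ), lam ∈ Set.Ioo (0 : ℝ) 1 :=
      Ioo_mem_nhdsLT one_pos
    exact (hfreq.and_eventually h01).mono fun lam h => ⟨h.2.1.le, h.2.2, h.1⟩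
  let l := 𝓝[<] (1 : ℝ) ⊓ 𝓟 {lam | Good lam}
  have hne : l.NeBot := frequently_mem_iff_neBot.1 hgood
  have hl : ∀ᶠ lam in l, Good lam := mem_inf_of_right (mem_principal_self _)
  let Kc : Set (G.S → ℝ) := Set.pi Set.univ (fun _ => Set.Icc (-C) C) ∩ {φ | φ s0 ≤ b}
  have hKc : IsCompact Kc := (isCompact_univ_pi fun _ => isCompact_Icc).inter_right
    (isClosed_le (continuous_apply s0) continuous_const)
  have hev : ∀ᶠ lam in l, Φ lam ∈ Kc := hl.mono fun lam hlam =>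
    ⟨fun s _ => abs_le.1 ((hΦ lam hlam).2.1 s), (hΦ lam hlam).2.2⟩
  obtain ⟨φl, hφl, hcl⟩ := hKc.exists_mapClusterPt_of_frequently hev.frequently
  refine ⟨φl, hφl.2, fun η hη => ?_⟩
  have hfr := (hcl.frequently (Metric.ball_mem_nhds φl hη)).and_eventually hl
  refine (hfr.filter_mono inf_le_left).mono fun lam h => ?_
  obtain ⟨⟨α, ξ, hα, hξ⟩, hb, -⟩ := hΦ lam h.2
  refine ⟨Φ lam, α, ξ, hα, hξ, hb, fun s => ?_⟩
  rw [← Real.dist_eq]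
  exact (dist_le_pi_dist _ _ s).trans (Metric.mem_ball.1 h.1).le

lemma exists_block_length {lam κ : ℝ} (h1 : lam < 1) (hκ : 1 - lam ≤ κ / 2) :
    ∃ L : ℕ, 1 ≤ L ∧ (1 - lam) * L ≤ κ ∧ κ / 2 ≤ (1 - lam) * L := by
  have h2 : 0 < 1 - lam := sub_pos.2 h1
  have h3 : 1 ≤ κ / (1 - lam) := by rw [le_div_iff₀ h2]; linarith
  refine ⟨⌊κ / (1 - lam)⌋₊, Nat.one_le_floor_iff _ |>.2 h3, ?_, ?_⟩
  · have := Nat.floor_le (zero_le_one.trans h3)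
    rw [le_div_iff₀ h2] at this
    linarith
  · have := Nat.lt_floor_add_one (κ / (1 - lam))
    rw [div_lt_iff₀ h2] at this
    linarith

lemma ind_eq_sum (Y : Set G.S) (t : G.S) : ind Y t = ∑ s, ind Y s * ind {s} t := by
  classical
  rw [Finset.sum_eq_single t]
  · simp [ind]
  · intro s _ hs
    simp [ind, Ne.symm hs]
  · simp

lemma expN_ind_eq_sum (σ : G.Profile) (s : G.S) (n : ℕ) (Y : Set G.S) :
    expN σ s n (fun h => ind Y h.2) = ∑ t, ind Y t * expN σ s n fun h => ind {t} h.2 := by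
  simp_rw [← expN_const_mul]
  rw [← expN_sum]
  exact expN_congr _ _ fun h _ => ind_eq_sum Y h.2

open Classical in
lemma mixPay_payoff {σ : G.Profile} {s : G.S} {T L : ℕ} {i : G.I} {Di : Finset (Finset G.S)}
    (hDi : IsPartitionF Di) {c : Finset G.S → ℝ} {C : ℝ} (hC : 1 ≤ C)
    (hc : ∀ D ∈ Di, |c D| ≤ C) {α : Finset G.S → ℝ} (hα : ∀ D, 0 ≤ α D ∧ α D ≤ 1)
    {w ε : ℝ} (hε : 0 ≤ ε) {Y : Set G.S}
    (hu : ∀ Y' : Set G.S, (w - ε) * L * expN σ s T (fun h => ind Y' h.2) - 3 * T ≤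
      ∑ n ∈ Finset.range L, expN σ s (T + n) fun h =>
        ind Y' (stAt T h) * avgG σ (fun st => G.u i st.1 st.2) h)
    (hsw : ∀ n, T ≤ n →
      expN σ s n (fun h => if sameOf Di (stAt T h) h.2 then 0 else 1) ≤ 2 * ε)
    (hcw : ∀ t ∈ Y, w ≤ c (partOf Di hDi t)) :
    (w - ε) * L * expN σ s T (fun h => ind Y h.2) - 3 * Fintype.card G.S * T - 4 * C * ε * L ≤
      ∑ n ∈ Finset.range L, expN σ s (T + n) fun h =>
        ind Y (stAt T h) * avgG σ (mixPay Di hDi c i α) h := by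
  set u' : G.Step → ℝ := fun st => G.u i st.1 st.2
  let A : G.S → ℝ := fun t => α (partOf Di hDi t)
  let B : G.S → ℝ := fun t => (1 - α (partOf Di hDi t)) * c (partOf Di hDi t)
  have hmix : ∀ h : G.Hist, avgG σ (mixPay Di hDi c i α) h = A h.2 * avgG σ u' h + B h.2 := by
    intro h
    simp only [avgG, mixPay, A, B, u', mul_add, Finset.sum_add_distrib, ← Finset.sum_mul,
      sum_pProb, one_mul]
    congr 1
    rw [Finset.mul_sum]
    exact Finset.sum_congr rfl fun a _ => by ring
  have hAB : ∀ (t : G.S) (h : G.Hist), |A t * avgG σ u' h + B t| ≤ C := fun t h =>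
    abs_convexComb_le (hα _) ((abs_avgG_le σ (fun st => G.u_bdd _ _ _) h).trans hC)
      (hc _ (partOf_mem hDi t).1)
  have hpt : ∀ h : G.Hist, ∑ t, (ind Y t * A t * (ind {t} (stAt T h) * avgG σ u' h) +
      ind Y t * B t * ind {t} (stAt T h)) ≤
      ind Y (stAt T h) * avgG σ (mixPay Di hDi c i α) h +
        2 * C * (if sameOf Di (stAt T h) h.2 then 0 else 1) := by
    intro h
    rw [Finset.sum_eq_single (stAt T h)]
    · rw [show ind {stAt T h} (stAt T h) = 1 from Set.indicator_of_mem rfl _, hmix]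
      have h1 := hAB (stAt T h) h
      have h2 := hAB h.2 h
      have h3 := ind_nonneg Y (stAt T h)
      have h4 := ind_le_one Y (stAt T h)
      split_ifs with hs
      · have hpe := partOf_eq_of_sameOf hDi hs
        simp only [A, B, hpe]
        linarith
      · rw [abs_le] at h1 h2
        nlinarith
    · intro t _ ht
      simp [ind, Ne.symm ht]
    · simp
  have hn : ∀ n ∈ Finset.range L,
      ∑ t, (ind Y t * A t * expN σ s (T + n) (fun h => ind {t} (stAt T h) * avgG σ u' h) +
        ind Y t * B t * expN σ s T (fun h => ind {t} h.2)) - 4 * C * ε ≤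
      expN σ s (T + n) fun h => ind Y (stAt T h) * avgG σ (mixPay Di hDi c i α) h := by
    intro n _
    have e1 := expN_mono σ s (n := T + n) fun h _ => hpt h
    rw [expN_add, expN_const_mul, expN_sum] at e1
    simp_rw [expN_linear] at e1
    simp_rw [fun t => expN_ind_stAt σ s {t} (show T ≤ T + n by omega)] at e1
    have e2 := mul_le_mul_of_nonneg_left (hsw (T + n) (by omega)) (show 0 ≤ 2 * C by linarith)
    linarith
  refine le_trans ?_ (Finset.sum_le_sum hn)
  rw [Finset.sum_sub_distrib, Finset.sum_comm, expN_ind_eq_sum]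
  simp only [Finset.sum_add_distrib, ← Finset.mul_sum, Finset.sum_const, Finset.card_range,
    nsmul_eq_mul]
  rw [← Finset.sum_add_distrib]
  have hterm : ∀ t ∈ (Finset.univ : Finset G.S),
      ind Y t * ((w - ε) * L * expN σ s T (fun h => ind {t} h.2)) - 3 * T ≤
      ind Y t * A t * ∑ n ∈ Finset.range L,
          expN σ s (T + n) (fun h => ind {t} (stAt T h) * avgG σ u' h) +
        ind Y t * (L * (B t * expN σ s T (fun h => ind {t} h.2))) := by
    intro t _
    have hT0 : (0 : ℝ) ≤ T := Nat.cast_nonneg _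
    by_cases ht : t ∈ Y
    · rw [show ind Y t = 1 from Set.indicator_of_mem ht _]
      have h1 := mul_le_mul_of_nonneg_left (hu {t}) (hα (partOf Di hDi t)).1
      have hP : 0 ≤ L * expN σ s T (fun h => ind {t} h.2) :=
        mul_nonneg (Nat.cast_nonneg _) (expN_nonneg _ _ fun h _ => ind_nonneg _ _)
      have h2 := (hα (partOf Di hDi t)).2
      have h3 := mul_le_mul_of_nonneg_left (show w - ε ≤ c (partOf Di hDi t) by
        linarith [hcw t ht]) (mul_nonneg (sub_nonneg.2 h2) hP)
      have h4 := mul_le_mul_of_nonneg_right h2 hT0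
      simp only [A, B]
      linarith
    · rw [show ind Y t = 0 from Set.indicator_of_notMem ht _]
      linarith
  have hsum := Finset.sum_le_sum hterm
  rw [Finset.sum_sub_distrib] at hsum
  simp only [Finset.sum_const, Finset.card_univ, nsmul_eq_mul] at hsum
  refine le_trans (le_of_eq ?_) ((sub_le_sub_right hsum (L * (4 * C * ε))).trans (le_of_eq ?_))
  · rw [Finset.mul_sum]
    have : ∀ t, (w - ε) * L * (ind Y t * expN σ s T fun h => ind {t} h.2) =
      ind Y t * ((w - ε) * L * expN σ s T fun h => ind {t} h.2) := fun t => by ring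
    rw [Finset.sum_congr rfl fun t _ => this t]
    ring
  · exact congrArg₂ _ (Finset.sum_congr rfl fun t _ => by ring) (by ring)

/-- The data used by the opponents of a player during a block of stages: a discount factor,
a length, a potential with the corresponding weights and stationary profile for the linearized
modified game, and a stationary profile that is nearly optimal in the original game. -/
structure Block (G : StocGame) where
  lam : ℝ
  len : ℕ
  pot : G.S → ℝ
  wt : Finset G.S → ℝ
  modProf : G.StatProf
  origProf : G.StatProf

/-- The block `b` starting at stage `T` approximates the potential `φl` and the value `v` with
accuracy `κ / (k + 1)`, and its discounted duration is of order `κ`. -/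
structure Block.Valid (b : Block G) (i : G.I) {Di : Finset (Finset G.S)} (hDi : IsPartitionF Di)
    (c : Finset G.S → ℝ) (C δ : ℝ) (v φl : G.S → ℝ) (κ : ℝ) (k T : ℕ) : Prop where
  nonneg : 0 ≤ b.lam
  lt_one : b.lam < 1
  one_le_len : 1 ≤ b.len
  len_le : (1 - b.lam) * b.len ≤ κ
  le_len : κ / 2 ≤ (1 - b.lam) * b.len
  start_le : (1 - b.lam) * T ≤ κ / (k + 1)
  wt_mem : ∀ D, 0 ≤ b.wt D ∧ b.wt D ≤ 1
  modBell : SubBell b.lam i b.modProf (mixPay Di hDi c i b.wt) b.pot ((1 - b.lam) * (δ / 8))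
  origBell : SubBell b.lam i b.origProf (fun st => G.u i st.1 st.2)
    (fun s => minmaxOrig G b.lam s i) ((1 - b.lam) * (δ / 8))
  abs_pot : ∀ s, |b.pot s| ≤ C
  pot_close : ∀ s, |b.pot s - φl s| ≤ κ / (k + 1)
  val_close : ∀ s, |minmaxOrig G b.lam s i - v s| ≤ κ / (k + 1)

lemma exists_block {i : G.I} {Di : Finset (Finset G.S)} (hDi : IsPartitionF Di)
    {c : Finset G.S → ℝ} {C δ : ℝ} (hδ : 0 < δ) {v φl : G.S → ℝ} (x : G.StatProf)
    (hv : ∀ s, Tendsto (fun lam => minmaxOrig G lam s i) (𝓝[<] (1 : ℝ)) (𝓝 (v s)))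
    (hφl : ∀ η > 0, ∃ᶠ lam in 𝓝[<] (1 : ℝ),
      ∃ (φ : G.S → ℝ) (α : Finset G.S → ℝ) (ξ : G.StatProf), (∀ D, 0 ≤ α D ∧ α D ≤ 1) ∧
        (∀ η' > 0, SubBell lam i ξ (mixPay Di hDi c i α) φ η') ∧ (∀ s, |φ s| ≤ C) ∧
        ∀ s, |φ s - φl s| ≤ η) {κ : ℝ} (hκ : 0 < κ) (k T : ℕ) :
    ∃ b : Block G, b.Valid i hDi c C δ v φl κ k T := by
  have hη : 0 < κ / (k + 1) := by positivity
  have e1 : ∀ᶠ lam in 𝓝[<] (1 : ℝ), ∀ s, |minmaxOrig G lam s i - v s| ≤ κ / (k + 1) := by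
    rw [eventually_all]
    intro s
    filter_upwards [(hv s).eventually (Metric.closedBall_mem_nhds _ hη)] with lam h
    simpa [Real.dist_eq] using h
  have e2 : ∀ᶠ lam in 𝓝[<] (1 : ℝ), 0 < lam ∧ lam < 1 := by
    filter_upwards [Ioo_mem_nhdsLT (zero_lt_one' ℝ)] with lam h using h
  have hlim : ∀ M : ℝ, Tendsto (fun lam : ℝ => (1 - lam) * M) (𝓝[<] 1) (𝓝 0) := fun M => by
    have : Tendsto (fun lam : ℝ => (1 - lam) * M) (𝓝 1) (𝓝 ((1 - 1) * M)) :=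
      Continuous.tendsto (by fun_prop) _
    rw [sub_self, zero_mul] at this
    exact this.mono_left nhdsWithin_le_nhds
  have e3 := (hlim T).eventually_le_const hη
  have e4 := (hlim 1).eventually_le_const (half_pos hκ)
  obtain ⟨lam, ⟨φ, α, ξ, hα, hS, hC, hφ⟩, h1, ⟨h2, h2'⟩, h3, h4⟩ :=
    ((hφl _ hη).and_eventually (e1.and (e2.and (e3.and e4)))).exists
  obtain ⟨L, hL1, hL2, hL3⟩ := exists_block_length h2' (by simpa using h4)
  have hpos : 0 < (1 - lam) * (δ / 8) := mul_pos (sub_pos.2 h2') (by positivity)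
  obtain ⟨ξv, hξv⟩ := subBell_minmaxOrig h2.le h2' i x hpos
  exact ⟨⟨lam, L, φ, α, ξ, ξv⟩, h2.le, h2', hL1, hL2, hL3, h3, hα, hS _ hpos, hξv, hC, hφ, h1⟩

lemma exists_schedule {i : G.I} {Di : Finset (Finset G.S)} {hDi : IsPartitionF Di}
    {c : Finset G.S → ℝ} {C δ : ℝ} {v φl : G.S → ℝ} {κ : ℕ → ℝ}
    (H : ∀ k T, ∃ b : Block G, b.Valid i hDi c C δ v φl (κ k) k T) :
    ∃ (b : ℕ → Block G) (T : ℕ → ℕ), T 0 = 0 ∧ (∀ k, T (k + 1) = T k + (b k).len) ∧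
      ∀ k, (b k).Valid i hDi c C δ v φl (κ k) k (T k) := by
  choose B hB using H
  let T : ℕ → ℕ := fun k => Nat.rec 0 (fun k t => t + (B k t).len) k
  exact ⟨fun k => B k (T k), T, rfl, fun _ => rfl, fun k => hB k (T k)⟩

/-- The index of the block containing stage `n`, when the `k`-th block starts at stage `T k`. -/
def blockIdx (T : ℕ → ℕ) (n : ℕ) : ℕ := Nat.findGreatest (fun k => T k ≤ n) n

lemma blockIdx_eq {T : ℕ → ℕ} (hT : StrictMono T) {k n : ℕ} (h1 : T k ≤ n) (h2 : n < T (k + 1)) :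
    blockIdx T n = k := by
  rw [blockIdx, Nat.findGreatest_eq_iff]
  refine ⟨(hT.id_le k).trans h1, fun _ => h1, fun m hm _ h => ?_⟩
  have := hT.monotone (Nat.succ_le_of_lt hm)
  simp only [Nat.succ_eq_add_one] at this
  omega

open Classical in
/-- In each block, the players follow the profile for the original game if the block started
at a state of value below `w`, and the profile for the modified game otherwise. -/
def blockProfile (b : ℕ → Block G) (T : ℕ → ℕ) (v : G.S → ℝ) (w : ℝ) : G.Profile := fun j h =>
  if v (stAt (T (blockIdx T h.1.length)) h) < w then
    (b (blockIdx T h.1.length)).origProf j h.2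
  else (b (blockIdx T h.1.length)).modProf j h.2

lemma expN_ind_eq_zero {σ : G.Profile} {s : G.S} {n : ℕ} {Y : Set G.S}
    (h : ∀ t ∈ Y, expN σ s n (fun h => ind {t} h.2) = 0) :
    expN σ s n (fun h => ind Y h.2) = 0 := by
  rw [expN_ind_eq_sum]
  refine Finset.sum_eq_zero fun t _ => ?_
  by_cases ht : t ∈ Y
  · rw [h t ht, mul_zero]
  · simp [ind, ht]

/-- Along a valid schedule of blocks, an opponent profile that follows `blockProfile` prevents
player `i` from having a subgame-perfect strategy if the potential at a state of high value is
too low. -/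
theorem false_of_schedule {i : G.I} {Di : Finset (Finset G.S)} {hDi : IsPartitionF Di}
    {c : Finset G.S → ℝ} {C δ ε w : ℝ} {v φl : G.S → ℝ} {κ : ℕ → ℝ} {b : ℕ → Block G}
    {T : ℕ → ℕ} {s : G.S} {σ : G.Profile} {N0 T1 : ℕ}
    (hC : 1 ≤ C) (hc : ∀ D ∈ Di, |c D| ≤ C) (hcv : ∀ D ∈ Di, ∀ t ∈ D, v t ≤ c D)
    (hδ : 0 < δ) (hδ1 : δ ≤ 1) (hε : 0 < ε) (hεδ : ε * (1 + 8 * C) ≤ δ / 2)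
    (hgv : ∀ t t', v t < v t' → v t + δ ≤ v t') (hgφ : ∀ t t', φl t < φl t' → φl t + δ ≤ φl t')
    (hw : v s = w) (hw1 : |w| ≤ 1) (hsw : φl s + δ ≤ w) (hmin : ∀ t, w ≤ v t → φl s ≤ φl t)
    (hκ0 : ∀ k, 0 < κ k) (hκ : ∀ k, (2 * C + 3) * κ k ≤ δ / 8 * (1 / 2) ^ k)
    (hT0 : T 0 = 0) (hT : ∀ k, T (k + 1) = T k + (b k).len)
    (hb : ∀ k, (b k).Valid i hDi c C δ v φl (κ k) k (T k))
    (hσ : ∀ j, j ≠ i → σ j = blockProfile b T v w j)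
    (hpay : ∀ (T N : ℕ) (Y : Set G.S), N0 ≤ T →
      (v s - ε) * (T + N * expN σ s T fun h => ind Y h.2) ≤
        T + ∑ n ∈ Finset.Ico T (T + N), expN σ s n fun h =>
          ind Y (stAt T h) * avgG σ (fun st => G.u i st.1 st.2) h)
    (hswitch : ∀ T n, T1 ≤ T → T ≤ n →
      expN σ s n (fun h => open Classical in
        if sameOf Di (stAt T h) h.2 then 0 else 1) ≤ 2 * ε) : False := by
  classical
  have hTm : StrictMono T := strictMono_nat_of_lt_succ fun k => by
    have := (hb k).one_le_len
    rw [hT]; omega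
  have hTk : ∀ k, k ≤ T k := hTm.id_le
  have hεδ' : ε ≤ δ / 2 := by nlinarith
  have hw2 := abs_le.1 hw1
  have hκρ : ∀ k, (2 * C + 3) * κ k ≤ δ * (1 / 2) ^ (k + 2) := fun k =>
    (hκ k).trans (by rw [pow_add]; nlinarith [pow_pos (by norm_num : (0 : ℝ) < 1 / 2) k])
  have hκδ : ∀ k, (2 * C + 2) * κ k ≤ δ / 8 := fun k => by
    have h1 := hκ k
    have h2 : ((1 : ℝ) / 2) ^ k ≤ 1 := pow_le_one₀ (by norm_num) (by norm_num)
    nlinarith [hκ0 k]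
  have hbase : ∀ (T L : ℕ) (Y : Set G.S), N0 ≤ T →
      (w - ε) * L * expN σ s T (fun h => ind Y h.2) - 3 * T ≤
        ∑ n ∈ Finset.range L, expN σ s (T + n) fun h =>
          ind Y (stAt T h) * avgG σ (fun st => G.u i st.1 st.2) h := by
    intro T L Y hTN
    have h := hpay T L Y hTN
    rw [Finset.sum_Ico_eq_sum_range, Nat.add_sub_cancel_left, hw] at h
    have hT0 : (0 : ℝ) ≤ T := Nat.cast_nonneg T
    nlinarith
  have hidx : ∀ (k : ℕ) (h : G.Hist), T k ≤ h.1.length → h.1.length < T k + (b k).len →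
      blockIdx T h.1.length = k := fun k h h1 h2 =>
    blockIdx_eq hTm h1 (by rw [hT]; exact h2)
  have hlow : ∀ t, v t < w → ∀ k, expN σ s (T k) (fun h => ind {t} h.2) = 0 := by
    by_contra hcon
    push Not at hcon
    obtain ⟨t0, ht0, k0, hk0⟩ := hcon
    let bad : Finset G.S := Finset.univ.filter fun t =>
      v t < w ∧ ∃ k, expN σ s (T k) (fun h => ind {t} h.2) ≠ 0
    obtain ⟨t, ht, htmin⟩ := bad.exists_min_image v ⟨t0, by simpa [bad] using ⟨ht0, k0, hk0⟩⟩
    obtain ⟨htw, j, hj⟩ : v t < w ∧ ∃ k, expN σ s (T k) (fun h => ind {t} h.2) ≠ 0 := by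
      simpa [bad] using ht
    have hgap : v t + δ ≤ w := hw ▸ hgv t s (hw ▸ htw)
    refine level_lemma (Y := {t' | v t' = v t}) (R := {t' | v t ≤ v t'}) (φl := v)
      (lam := fun k => (b k).lam) (L := fun k => (b k).len) (C := C) (ρ := δ) (δ := δ) (K := 3)
      (g := fun _ st => G.u i st.1 st.2) (φ := fun k s => minmaxOrig G (b k).lam s i)
      hT hC hδ hδ hδ1 (by norm_num) hκ0 hκρ hκδ (fun k => (hb k).lt_one) (fun k => (hb k).len_le)
      (fun k => (hb k).le_len) (fun k => (hb k).start_le) (fun k => (hb k).val_close)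
      (fun k t' => (abs_minmaxOrig_le (hb k).nonneg (hb k).lt_one (b k).modProf t' i).trans hC)
      (fun k st => (G.u_bdd _ _ _).trans hC) (fun t' h => h)
      (fun t' h1 h2 => hgv t t' (lt_of_le_of_ne h1 (Ne.symm h2))) (fun k => ?_)
      (fun k h h1 h2 h3 => ?_)
      (p := expN σ s (T j) fun h => ind {t} h.2)
      (lt_of_le_of_ne (expN_nonneg _ _ fun h _ => ind_nonneg _ _) (Ne.symm hj)) (j := j)
      (expN_mono _ _ fun h _ => ?_) ⟨N0, fun k hk _ => ?_⟩
    · refine expN_ind_eq_zero fun t' ht' => ?_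
      have hlt : v t' < v t := not_le.1 ht'
      by_contra hne
      exact absurd (htmin t' (by simpa [bad] using ⟨hlt.trans htw, k, hne⟩)) (not_le.2 hlt)
    · refine (hb k).origBell.hist fun m hm => ?_
      have : v (stAt (T k) h) < w := by rw [show v (stAt (T k) h) = v t from h3]; exact htw
      rw [hσ m hm, blockProfile, hidx k h h1 h2, if_pos this]
    · by_cases hh : h.2 = t
      · simp [ind, hh]
      · simp only [ind, Set.indicator_of_notMem (show h.2 ∉ ({t} : Set G.S) from hh)]
        exact ind_nonneg _ _
    · refine le_trans ?_ (hbase (T k) (b k).len _ (hk.trans (hTk k)))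
      have hL : (0 : ℝ) ≤ (b k).len * expN σ s (T k) (fun h => ind {t' | v t' = v t} h.2) :=
        mul_nonneg (Nat.cast_nonneg _) (expN_nonneg _ _ fun h _ => ind_nonneg _ _)
      have : (v t + δ / 2) ≤ w - ε := by linarith
      nlinarith
  refine level_lemma (Y := {t | w ≤ v t ∧ φl t = φl s}) (R := {t | w ≤ v t}) (φl := φl)
    (lam := fun k => (b k).lam) (L := fun k => (b k).len) (C := C) (ρ := δ) (δ := δ)
    (K := 3 * Fintype.card G.S)
    (g := fun k => mixPay Di hDi c i (b k).wt) (φ := fun k => (b k).pot)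
    hT hC hδ hδ hδ1 (by positivity) hκ0 hκρ hκδ (fun k => (hb k).lt_one) (fun k => (hb k).len_le)
    (fun k => (hb k).le_len) (fun k => (hb k).start_le) (fun k => (hb k).pot_close)
    (fun k => (hb k).abs_pot)
    (fun k => abs_mixPay_le hDi hC hc i (hb k).wt_mem) (fun t h => h.2)
    (fun t h1 h2 => hgφ s t (lt_of_le_of_ne (hmin t h1) fun h => h2 ⟨h1, h.symm⟩))
    (fun k => expN_ind_eq_zero fun t ht => hlow t (not_le.1 ht) k)
    (fun k h h1 h2 h3 => ?_) (p := 1) one_pos (j := 0) ?_ ⟨max N0 T1, fun k hk hP => ?_⟩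
  · refine (hb k).modBell.hist fun m hm => ?_
    rw [hσ m hm, blockProfile, hidx k h h1 h2, if_neg (not_lt.2 h3.1)]
  · rw [hT0]
    simp [expN, ind, hw]
  · have hTk' := hk.trans (hTk k)
    refine le_trans ?_ (mixPay_payoff hDi hC hc (hb k).wt_mem hε.le
      (fun Y' => hbase (T k) (b k).len Y' ((le_max_left _ _).trans hTk'))
      (fun n hn => hswitch (T k) n ((le_max_right _ _).trans hTk') hn)
      fun t ht => ht.1.trans (hcv _ (partOf_mem hDi t).1 t (partOf_mem hDi t).2))
    set P := expN σ s (T k) (fun h => ind {t | w ≤ v t ∧ φl t = φl s} h.2)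
    have hL : (0 : ℝ) ≤ (b k).len := Nat.cast_nonneg _
    have h1 : (0 : ℝ) ≤ (b k).len * P := mul_nonneg hL (by linarith)
    have h2 : φl s + δ / 2 ≤ w - ε * (1 + 8 * C) := by linarith
    have h3 := mul_le_mul_of_nonneg_right h2 h1
    have h4 : 0 ≤ 8 * C * ε * (b k).len * (P - 1 / 2) :=
      mul_nonneg (by positivity) (by linarith)
    nlinarith

/-- Under Property P', the modified payoff at an equilibrium is, up to any fixed error, at least
the min-max value when the discount factor is close to `1`. -/
theorem eventually_le_modPayoff {μfam : G.S → G.Profile → Measure G.Play} (hind : IsInduced μfam)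
    {i : G.I} {v : G.S → ℝ}
    (hv : ∀ s, Tendsto (fun lam => minmaxOrig G lam s i) (𝓝[<] (1 : ℝ)) (𝓝 (v s)))
    {s0 : G.S} {Di : Finset (Finset G.S)} (hDi : IsPartitionF Di) (hP : PropertyP' μfam v i Di)
    {c : Finset G.S → ℝ} (hc : ∀ D ∈ Di, ∀ s ∈ D, v s ≤ c D) {x : ℝ → G.StatProf}
    (hx : ∀ lam : ℝ, 0 ≤ lam → lam < 1 → ∀ σi : G.BStrat i,
      modPayoff lam s0 (Function.update (toB (x lam)) i σi) i Di c ≤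
        modPayoff lam s0 (toB (x lam)) i Di c) {d : ℝ} (hd : 0 < d) :
    ∀ᶠ lam in 𝓝[<] (1 : ℝ), v s0 - d ≤ modPayoff lam s0 (toB (x lam)) i Di c := by
  classical
  by_contra hcon
  rw [not_eventually] at hcon
  simp only [not_le] at hcon
  let C : ℝ := 1 + ∑ D ∈ Di, |c D|
  have hC : 1 ≤ C := le_add_of_nonneg_right (Finset.sum_nonneg fun _ _ => abs_nonneg _)
  have hcC : ∀ D ∈ Di, |c D| ≤ C := fun D hD =>
    (Finset.single_le_sum (f := fun D => |c D|) (fun _ _ => abs_nonneg _) hD).trans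
      (le_add_of_nonneg_left zero_le_one)
  obtain ⟨φl, hφ0, hφl⟩ := exists_limit_potential hDi hC hcC hx hcon
  have hv1 : ∀ s, |v s| ≤ 1 := fun s => by
    refine le_of_tendsto (hv s).abs ?_
    filter_upwards [Ioo_mem_nhdsLT (zero_lt_one' ℝ)] with lam h
    exact abs_minmaxOrig_le h.1.le h.2 (x 0) s i
  obtain ⟨s, hs, hsmin⟩ := (Finset.univ.filter fun t => v s0 ≤ v t).exists_min_image φl
    ⟨s0, by simp⟩
  simp only [Finset.mem_filter, Finset.mem_univ, true_and] at hs hsmin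
  obtain ⟨ρ1, hρ1, hgv⟩ := exists_gap v
  obtain ⟨ρ2, hρ2, hgφ⟩ := exists_gap φl
  let δ : ℝ := min d (min 1 (min ρ1 ρ2))
  have hδ : 0 < δ := lt_min hd (lt_min one_pos (lt_min hρ1 hρ2))
  have hδd : δ ≤ d := min_le_left _ _
  have hδ1 : δ ≤ 1 := (min_le_right _ _).trans (min_le_left _ _)
  have hδρ1 : δ ≤ ρ1 := (min_le_right _ _).trans ((min_le_right _ _).trans (min_le_left _ _))
  have hδρ2 : δ ≤ ρ2 := (min_le_right _ _).trans ((min_le_right _ _).trans (min_le_right _ _))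
  have hC3 : 0 < 2 * C + 3 := by linarith
  let κ : ℕ → ℝ := fun k => δ / 8 * (1 / 2) ^ k / (2 * C + 3)
  have hκ0 : ∀ k, 0 < κ k := fun k => by positivity
  obtain ⟨b, T, hT0, hT, hb⟩ := exists_schedule fun k T =>
    exists_block hDi (δ := δ) hδ (x 0) hv hφl (hκ0 k) k T
  have hC8 : 0 < 1 + 8 * C := by linarith
  let ε : ℝ := δ / 2 / (1 + 8 * C)
  have hε : 0 < ε := by positivity
  have hεδ : ε * (1 + 8 * C) = δ / 2 := div_mul_cancel₀ _ hC8.ne'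
  obtain ⟨ζ, -, hζ⟩ := hP
  obtain ⟨σi, hsub, E, hE, hZ⟩ := hζ ε hε s (blockProfile b T v (v s))
  obtain ⟨N0, hpay⟩ := block_payoff hind hsub
  obtain ⟨T1, hswitch⟩ := few_switches hind hDi hε (by nlinarith) hE hZ
  exact false_of_schedule hC hcC hc hδ hδ1 hε hεδ.le
    (fun t t' h => (add_le_add_right hδρ1 _).trans (hgv t t' h))
    (fun t t' h => (add_le_add_right hδρ2 _).trans (hgφ t t' h)) rfl (hv1 s)
    (by have := hsmin s0 le_rfl; linarith) (fun t ht => hsmin t (hs.trans ht)) hκ0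
    (fun k => (mul_div_cancel₀ _ hC3.ne').le) hT0 hT hb
    (fun j hj => Function.update_of_ne hj _ _) hpay hswitch

lemma modPayoff_le_card {lam : ℝ} (h0 : 0 ≤ lam) (h1 : lam < 1) (s0 : G.S) (σ : G.Profile)
    (i : G.I) (Di : Finset (Finset G.S)) (c : Finset G.S → ℝ) :
    modPayoff lam s0 σ i Di c ≤ Di.card := by
  have hU : ∀ D, UD lam s0 σ i D ≤ 1 := fun D => by
    have hg : ∀ st : G.Step, |if st.1 ∈ D then G.u i st.1 st.2 else 0| ≤ 1 := fun st => by
      split_ifs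
      · exact G.u_bdd _ _ _
      · simp
    refine le_trans (le_of_eq ?_) (abs_le.1 (abs_payG_le h0 h1 s0 σ hg)).2
    exact Finset.sum_congr rfl fun st _ => by by_cases h : st.1 ∈ D <;> simp [h]
  calc modPayoff lam s0 σ i Di c ≤ ∑ _D ∈ Di, (1 : ℝ) :=
        Finset.sum_le_sum fun D _ => (min_le_left _ _).trans (hU D)
    _ = Di.card := by simp

end StocGame

end

open StocGame in
/-- the liminf, as the discount factor goes to `1`, of the modified payoff
of player `i` under stationary equilibria of the modified game is at least his uniform
min-max value at the initial state. -/
theorem stmt_12 (G : StocGame) (μfam : G.S → G.Profile → Measure G.Play)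
    (hind : IsInduced μfam) (vbar : G.I → G.S → ℝ)
    (hv : ∀ (i : G.I) (s0 : G.S),
      Tendsto (fun lam => minmaxOrig G lam s0 i) (𝓝[<] (1 : ℝ)) (𝓝 (vbar i s0)))
    (s0 : G.S) (Di : G.I → Finset (Finset G.S)) (hDi : ∀ i, IsPartitionF (Di i))
    (hP' : ∀ i : G.I, PropertyP' μfam (vbar i) i (Di i))
    (c : G.I → Finset G.S → ℝ)
    (hc : ∀ i : G.I, ∀ D ∈ Di i, ∀ s ∈ D, vbar i s ≤ c i D)
    (x : ℝ → G.StatProf)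
    (hx : ∀ lam : ℝ, 0 ≤ lam → lam < 1 → ∀ (i : G.I) (σi : G.BStrat i),
      modPayoff lam s0 (Function.update (toB (x lam)) i σi) i (Di i) (c i) ≤
        modPayoff lam s0 (toB (x lam)) i (Di i) (c i))
    (i : G.I) :
    vbar i s0 ≤
      Filter.liminf (fun lam => modPayoff lam s0 (toB (x lam)) i (Di i) (c i))
        (𝓝[<] (1 : ℝ)) := by
  have hnhds : ∀ᶠ lam in 𝓝[<] (1 : ℝ), 0 ≤ lam ∧ lam < 1 := by
    filter_upwards [Ioo_mem_nhdsLT (zero_lt_one' ℝ)] with lam h using ⟨h.1.le, h.2⟩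
  refine le_of_forall_sub_le fun d hd => ?_
  refine le_liminf_of_le ?_ (eventually_le_modPayoff hind (hv i) (hDi i) (hP' i) (hc i)
    (fun lam h0 h1 => hx lam h0 h1 i) hd)
  exact IsCoboundedUnder.of_frequently_le (a := ((Di i).card : ℝ))
    (hnhds.mono fun lam h => modPayoff_le_card h.1 h.2 _ _ _ _ _).frequently
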